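/- Let 𝒜 ⊆ ℂ^N be an irreducible algebraic set of positive dimension (equivalently, infinite) and let f : 𝒜 → ℂ^M be a polynomial mapping on 𝒜 such that ℬ := f(𝒜) is an irreducible algebraic subset of ℂ^M. Let b ∈ ℬ and δ > 0, put K := ℬ ∩ B̄(b,δ) (B̄ the closed Euclidean ball), and assume f⁻¹(K) is compact. If there exists d > 0 such that d · V_{f⁻¹(K)}(z) ≤ V_K(f(z)) for all z ∈ 𝒜, then liminf_{𝒜∋z→∞} log‖f(z)‖/log‖z‖ ≥ d, i.e. the Łojasiewicz exponent satisfies L∞(f|𝒜) ≥ d. -/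

import Mathlib

open Filter MvPolynomial Metric Set ENNReal

/-- extended logarithm of a nonnegative real number, with `elog 0 = -∞`. -/
noncomputable def elog (t : ℝ) : EReal := if t = 0 then ⊥ else ((Real.log t : ℝ) : EReal)

/-- the filter of points of `V` whose norm tends to infinity. -/
def atInftyOn {E : Type*} [Norm E] (V : Set E) : Filter E :=
  (Filter.comap (fun z => ‖z‖) Filter.atTop) ⊓ Filter.principal V

/-- the quotient `log ‖f z‖ / log ‖z‖`, computed in the extended reals. -/
noncomputable def logRatio {E F : Type*} [Norm E] [Norm F] (f : E → F) (z : E) : EReal :=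
  elog ‖f z‖ / elog ‖z‖

/-- the growth exponent `ρ(f, V)` of `f` on `V`. -/
noncomputable def growthExp {E F : Type*} [Norm E] [Norm F] (f : E → F) (V : Set E) : EReal :=
  Filter.limsup (logRatio f) (atInftyOn V)

/-- `log ‖f⁻¹(w)‖ = log sup {‖z‖ : z ∈ V, f z = w}`, computed in the extended reals
(`-∞` for an empty fiber). -/
noncomputable def fiberLogNorm {E F : Type*} [Norm E] [Norm F] (f : E → F) (V : Set E)
    (w : F) : EReal :=
  sSup ((fun z => elog ‖z‖) '' {z | z ∈ V ∧ f z = w})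

/-- the order `ρ(f⁻¹, f(V))` of `f` on `V`: the growth exponent of the multifunction `f⁻¹`
on `f(V)`. -/
noncomputable def orderExp {E F : Type*} [Norm E] [Norm F] (f : E → F) (V : Set E) : EReal :=
  Filter.limsup (fun w => fiberLogNorm f V w / elog ‖w‖) (atInftyOn (f '' V))

/-- the Łojasiewicz exponent at infinity `L∞(f|V)`, with `sup ∅ = -∞`. -/
noncomputable def lojExp {E F : Type*} [Norm E] [Norm F] (f : E → F) (V : Set E) : EReal :=
  sSup {x : EReal | ∃ d : ℝ, x = (d : EReal) ∧
    ∃ C : ℝ, 0 < C ∧ ∃ R : ℝ, 0 < R ∧ ∀ z ∈ V, R < ‖z‖ → C * ‖z‖ ^ d < ‖f z‖}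

/-- inverse on `[0,+∞] ⊆ EReal` with the conventions `1/∞ = 0` and `1/0 = ∞`. -/
noncomputable def invE (x : EReal) : EReal :=
  if x = ⊤ then 0 else if x = 0 then ⊤ else (((x.toReal)⁻¹ : ℝ) : EReal)

/-- evaluation of a polynomial of `n` variables at a point of `ℂⁿ`. -/
noncomputable def evalAt {n : ℕ} (z : EuclideanSpace ℂ (Fin n))
    (p : MvPolynomial (Fin n) ℂ) : ℂ :=
  MvPolynomial.eval (fun i => z i) p

/-- an algebraic subset of `ℂⁿ`: the common zero set of finitely many polynomials. -/
def IsAlgebraicSet {n : ℕ} (A : Set (EuclideanSpace ℂ (Fin n))) : Prop :=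
  ∃ S : Finset (MvPolynomial (Fin n) ℂ), A = {z | ∀ p ∈ S, evalAt z p = 0}

/-- the ideal of all polynomials vanishing identically on `A`. -/
noncomputable def vanishIdeal {n : ℕ} (A : Set (EuclideanSpace ℂ (Fin n))) :
    Ideal (MvPolynomial (Fin n) ℂ) :=
  RingHom.ker (Pi.ringHom fun z : A =>
    MvPolynomial.eval (fun i => (z : EuclideanSpace ℂ (Fin n)) i))

/-- a polynomial mapping on `A`: the restriction to `A` of a mapping all of whose
components are polynomials. -/
def IsPolyMapOn {N M : ℕ} (f : EuclideanSpace ℂ (Fin N) → EuclideanSpace ℂ (Fin M))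
    (A : Set (EuclideanSpace ℂ (Fin N))) : Prop :=
  ∃ P : Fin M → MvPolynomial (Fin N) ℂ, ∀ z ∈ A, ∀ j, f z j = evalAt z (P j)

/-- a holomorphic mapping on `A`: locally the restriction of a holomorphic mapping on an
open subset of the ambient space. -/
def IsHoloOn {N M : ℕ} (f : EuclideanSpace ℂ (Fin N) → EuclideanSpace ℂ (Fin M))
    (A : Set (EuclideanSpace ℂ (Fin N))) : Prop :=
  ∀ z ∈ A, ∃ U : Set (EuclideanSpace ℂ (Fin N)), IsOpen U ∧ z ∈ U ∧
    ∃ F : EuclideanSpace ℂ (Fin N) → EuclideanSpace ℂ (Fin M),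
      DifferentiableOn ℂ F U ∧ Set.EqOn f F (U ∩ A)

/-- the pluricomplex Green function of a compact set `K ⊆ ℂⁿ`, in its Siciak–Zaharjuta
polynomial form `V_K(z) = sup { (deg q)⁻¹ · log⁺ |q(z)| }`. -/
noncomputable def greenV {n : ℕ} (K : Set (EuclideanSpace ℂ (Fin n)))
    (z : EuclideanSpace ℂ (Fin n)) : EReal :=
  sSup {x : EReal | ∃ q : MvPolynomial (Fin n) ℂ, 1 ≤ q.totalDegree ∧
    (∀ w ∈ K, ‖evalAt w q‖ ≤ 1) ∧
    x = (((q.totalDegree : ℝ)⁻¹ * max (Real.log ‖evalAt z q‖) 0 : ℝ) : EReal)}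

open scoped Topology


/-- removable singularities at finitely many points -/
theorem aux_removable (F : Finset ℂ) : ∀ (g : ℂ → ℂ),
    (∀ z, z ∉ F → DifferentiableAt ℂ g z) →
    (∀ R : ℝ, ∃ B : ℝ, ∀ z, z ∉ F → ‖z‖ ≤ R → ‖g z‖ ≤ B) →
    ∃ G : ℂ → ℂ, Differentiable ℂ G ∧ ∀ z, z ∉ F → G z = g z := by
  induction F using Finset.induction_on with
  | empty =>
    intro g hg _
    exact ⟨g, fun z => hg z (by simp), fun _ _ => rfl⟩
  | insert a F ha ih =>
    intro g hg hb
    have hopen : IsOpen ((F : Set ℂ)ᶜ) := F.finite_toSet.isClosed.isOpen_compl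
    set s : Set ℂ := (F : Set ℂ)ᶜ ∩ ball a 1 with hs
    have hsn : s ∈ 𝓝 a := inter_mem (hopen.mem_nhds (by simpa using ha)) (ball_mem_nhds a one_pos)
    obtain ⟨B, hB⟩ := hb (‖a‖ + 1)
    have hd : DifferentiableOn ℂ g (s \ {a}) := by
      intro z hz
      refine (hg z ?_).differentiableWithinAt
      simp only [Finset.mem_insert, not_or]
      exact ⟨hz.2, by simpa using hz.1.1⟩
    have hbd : BddAbove (norm ∘ g '' (s \ {a})) := by
      refine ⟨B, ?_⟩
      rintro _ ⟨z, hz, rfl⟩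
      refine hB z ?_ ?_
      · simp only [Finset.mem_insert, not_or]
        exact ⟨hz.2, by simpa using hz.1.1⟩
      · have h1 : dist z a < 1 := hz.1.2
        rw [dist_eq_norm] at h1
        have := norm_add_le (z - a) a
        simp only [sub_add_cancel] at this
        linarith
    have key := Complex.differentiableOn_update_limUnder_of_bddAbove hsn hd hbd
    set g' := Function.update g a (limUnder (𝓝[≠] a) g) with hg'
    have c1 : ∀ z, z ∉ F → DifferentiableAt ℂ g' z := by
      intro z hz
      by_cases hza : z = a
      · subst hza
        exact key.differentiableAt hsn
      · have h1 : DifferentiableAt ℂ g z := hg z (by simp [hza, hz])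
        refine h1.congr_of_eventuallyEq ?_
        filter_upwards [isOpen_ne.mem_nhds hza] with x hx
        rw [hg', Function.update_of_ne hx]
    have c2 : ∀ R : ℝ, ∃ B : ℝ, ∀ z, z ∉ F → ‖z‖ ≤ R → ‖g' z‖ ≤ B := by
      intro R
      obtain ⟨B, hB⟩ := hb R
      refine ⟨max B ‖limUnder (𝓝[≠] a) g‖, fun z hz hzR => ?_⟩
      by_cases hza : z = a
      · subst hza
        simp [hg']
      · rw [hg', Function.update_of_ne hza]
        exact (hB z (by simp [hza, hz]) hzR).trans (le_max_left _ _)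
    obtain ⟨G, hG, hGe⟩ := ih g' c1 c2
    refine ⟨G, hG, fun z hz => ?_⟩
    simp only [Finset.mem_insert, not_or] at hz
    rw [hGe z hz.2, hg', Function.update_of_ne hz.1]

/-- Taylor coefficient bound -/
theorem aux_coeff {g : ℂ → ℂ} {R B : ℝ} (hR : 0 < R) (hg : DiffContOnCl ℂ g (ball 0 R))
    (hB : ∀ z, ‖z‖ = R → ‖g z‖ ≤ B) (j : ℕ) :
    ‖(j.factorial : ℂ)⁻¹ * iteratedDeriv j g 0‖ ≤ B / R ^ j := by
  have h := Complex.norm_iteratedDeriv_le_of_forall_mem_sphere_norm_le j hR hg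
    (C := B) (fun z hz => hB z (by simpa using hz))
  rw [norm_mul, norm_inv, Complex.norm_natCast]
  have hp : (0 : ℝ) < j.factorial := by positivity
  rw [inv_mul_le_iff₀ hp]
  calc _ ≤ _ := h
    _ = _ := by ring

theorem aux_entire_poly {g : ℂ → ℂ} (hg : Differentiable ℂ g) {C : ℝ} {n : ℕ}
    (hb : ∀ z, ‖g z‖ ≤ C * (1 + ‖z‖) ^ n) (z : ℂ) :
    g z = ∑ j ∈ Finset.range (n + 1), ((j.factorial : ℂ)⁻¹ * iteratedDeriv j g 0) * z ^ j := by
  have hC : 0 ≤ C := by simpa using (norm_nonneg _).trans (hb 0)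
  have hz : ∀ j, n < j → (j.factorial : ℂ)⁻¹ * iteratedDeriv j g 0 = 0 := by
    intro j hj
    rw [← norm_eq_zero]
    refine le_antisymm ?_ (norm_nonneg _)
    have h1 : ∀ R : ℝ, 1 ≤ R → ‖(j.factorial : ℂ)⁻¹ * iteratedDeriv j g 0‖ ≤ C * 2 ^ n / R := by
      intro R hR
      have h0 : 0 < R := by linarith
      have := aux_coeff (g := g) (R := R) (B := C * (1 + R) ^ n) h0 hg.diffContOnCl
        (fun z hz => by rw [← hz]; exact hb z) j
      refine this.trans ?_
      rw [div_le_div_iff₀ (by positivity) h0]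
      have e1 : (1 + R) ^ n ≤ (2 * R) ^ n := by gcongr; linarith
      have e2 : R ^ n * R ≤ R ^ j := by
        rw [← pow_succ]
        exact pow_le_pow_right₀ hR hj
      calc C * (1 + R) ^ n * R ≤ C * (2 * R) ^ n * R := by gcongr
        _ = C * 2 ^ n * (R ^ n * R) := by rw [mul_pow]; ring
        _ ≤ _ := by gcongr
    have h2 : Tendsto (fun R : ℝ => C * 2 ^ n / R) atTop (𝓝 0) :=
      tendsto_const_nhds.div_atTop tendsto_id
    exact ge_of_tendsto h2 ((eventually_ge_atTop 1).mono h1)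
  have hs := Complex.hasSum_taylorSeries_of_entire hg 0 z
  have hs2 := hasSum_sum_of_ne_finset_zero (s := Finset.range (n + 1)) (L := SummationFilter.unconditional ℕ)
    (f := fun j : ℕ => ((j.factorial : ℂ)⁻¹ * iteratedDeriv j g 0) * z ^ j) (fun j hj => by
      rw [hz j (by simpa using hj), zero_mul])
  refine hs.unique ?_
  have he : (fun j : ℕ => (j.factorial : ℂ)⁻¹ • (z - 0) ^ j • iteratedDeriv j g 0) =
      fun j : ℕ => ((j.factorial : ℂ)⁻¹ * iteratedDeriv j g 0) * z ^ j := by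
    funext j
    simp only [smul_eq_mul, sub_zero]
    ring
  rw [he]
  exact hs2

/-- polynomial growth off a finite set: the function is a polynomial, with Bernstein–Walsh. -/
theorem aux_line (F : Finset ℂ) (g : ℂ → ℂ) (hg : ∀ z, z ∉ F → DifferentiableAt ℂ g z)
    {C : ℝ} {n : ℕ} (hb : ∀ z, z ∉ F → ‖g z‖ ≤ C * (1 + ‖z‖) ^ n) :
    ∃ c : ℕ → ℂ, (∀ z, z ∉ F → g z = ∑ j ∈ Finset.range (n + 1), c j * z ^ j) ∧
      ∀ (r A : ℝ), 0 < r → (∀ z, z ∉ F → ‖z‖ ≤ r → ‖g z‖ ≤ A) → ∀ j, ‖c j‖ ≤ A / r ^ j := by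
  have hdense : Dense ((F : Set ℂ)ᶜ) := F.finite_toSet.countable.dense_compl ℂ
  have hC : 0 ≤ C := by
    obtain ⟨z, hz⟩ := hdense.nonempty
    have := (norm_nonneg _).trans (hb z (by simpa using hz))
    exact nonneg_of_mul_nonneg_left this (by positivity)
  obtain ⟨G, hG, hGe⟩ := aux_removable F g hg (fun R => ⟨C * (1 + R) ^ n, fun z hz hzR =>
    (hb z hz).trans (by gcongr)⟩)
  have hbG : ∀ z, ‖G z‖ ≤ C * (1 + ‖z‖) ^ n := by
    have hcl : IsClosed {z | ‖G z‖ ≤ C * (1 + ‖z‖) ^ n} :=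
      isClosed_le hG.continuous.norm (by fun_prop)
    intro z
    have : (F : Set ℂ)ᶜ ⊆ {z | ‖G z‖ ≤ C * (1 + ‖z‖) ^ n} := by
      intro z hz
      have hz' : z ∉ F := by simpa using hz
      change ‖G z‖ ≤ _
      rw [hGe z hz']
      exact hb z hz'
    exact hcl.closure_subset_iff.2 this (hdense z)
  refine ⟨fun j => (j.factorial : ℂ)⁻¹ * iteratedDeriv j G 0, fun z hz => ?_, ?_⟩
  · rw [← hGe z hz]
    exact aux_entire_poly hG hbG z
  · intro r A hr hA j
    have hbA : ∀ z ∈ ball (0 : ℂ) r, ‖G z‖ ≤ A := by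
      intro z hz
      have hmem : z ∈ closure (ball (0 : ℂ) r ∩ (F : Set ℂ)ᶜ) :=
        hdense.open_subset_closure_inter isOpen_ball hz
      have hcl : IsClosed {z | ‖G z‖ ≤ A} := isClosed_le hG.continuous.norm continuous_const
      refine hcl.closure_subset_iff.2 ?_ hmem
      rintro x ⟨hx1, hx2⟩
      have hx2' : x ∉ F := by simpa using hx2
      change ‖G x‖ ≤ _
      rw [hGe x hx2']
      exact hA x hx2' (by simpa using (mem_ball_zero_iff.1 hx1).le)
    refine aux_coeff hr hG.diffContOnCl (fun z hz => ?_) j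
    have hmem : z ∈ closure (ball (0 : ℂ) r) := by
      rw [closure_ball _ hr.ne']; simp [hz]
    have hcl : IsClosed {z | ‖G z‖ ≤ A} := isClosed_le hG.continuous.norm continuous_const
    exact hcl.closure_subset_iff.2 hbA hmem

theorem aux_bw (F : Finset ℂ) (g : ℂ → ℂ) (hg : ∀ z, z ∉ F → DifferentiableAt ℂ g z)
    {C : ℝ} {n : ℕ} (hb : ∀ z, z ∉ F → ‖g z‖ ≤ C * (1 + ‖z‖) ^ n)
    {r A ρ : ℝ} (hr : 0 < r) (hA : ∀ z, z ∉ F → ‖z‖ ≤ r → ‖g z‖ ≤ A)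
    (hρ : 1 ≤ ρ) {z : ℂ} (hz : z ∉ F) (hzρ : ‖z‖ ≤ r * ρ) :
    ‖g z‖ ≤ (n + 1) * (A * ρ ^ n) := by
  obtain ⟨c, hc, hcb⟩ := aux_line F g hg hb
  have hcb := hcb r A hr hA
  have hA0 : 0 ≤ A := by simpa using (norm_nonneg _).trans (hcb 0)
  rw [hc z hz]
  calc _ ≤ ∑ j ∈ Finset.range (n + 1), ‖c j * z ^ j‖ := norm_sum_le _ _
    _ ≤ ∑ j ∈ Finset.range (n + 1), A * ρ ^ n := by
      refine Finset.sum_le_sum fun j hj => ?_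
      rw [norm_mul, norm_pow]
      calc ‖c j‖ * ‖z‖ ^ j ≤ A / r ^ j * (r * ρ) ^ j := by gcongr; exact hcb j
        _ = A * ρ ^ j := by rw [mul_pow]; field_simp
        _ ≤ A * ρ ^ n := by
          gcongr
          · have := Finset.mem_range.1 hj; omega
    _ = _ := by simp

/-- two-constants type estimate -/
theorem aux_two_const {r : ℝ} (hr : 0 < r) (hr1 : r ≤ 1) :
    ∃ τ : ℝ, 0 < τ ∧ τ < 1 ∧ ∃ H : ℝ, 1 ≤ H ∧ ∀ (g : ℂ → ℂ) (e B : ℝ), 0 < e → 0 < B →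
      (∀ z, ‖z‖ < 2 → DifferentiableAt ℂ g z) → (∀ z, ‖z‖ < 2 → ‖g z‖ ≤ B) →
      (∀ z, ‖z‖ ≤ r → ‖g z‖ ≤ e) → ‖g 1‖ ≤ H * (e ^ τ * B ^ (1 - τ)) := by
  -- choose τ with r^τ (3/2)^(1-τ) > 1
  have hlim : Tendsto (fun τ : ℝ => r ^ τ * (3 / 2 : ℝ) ^ (1 - τ)) (𝓝[>] 0) (𝓝 (3 / 2)) := by
    have : ContinuousAt (fun τ : ℝ => r ^ τ * (3 / 2 : ℝ) ^ (1 - τ)) 0 := by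
      refine ContinuousAt.mul ?_ ?_
      · exact continuousAt_const.rpow continuousAt_id (Or.inl hr.ne')
      · exact continuousAt_const.rpow (by fun_prop) (Or.inl (by norm_num))
    have h := this.tendsto.mono_left (nhdsWithin_le_nhds (s := Ioi 0))
    simpa using h
  have hev := (hlim.eventually (lt_mem_nhds (show (1 : ℝ) < 3 / 2 by norm_num))).and
    (Ioo_mem_nhdsGT (show (0 : ℝ) < 1 by norm_num))
  obtain ⟨τ, hτ, hτ0, hτ1⟩ := hev.exists
  set x := (r ^ τ * (3 / 2 : ℝ) ^ (1 - τ))⁻¹ with hx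
  have hx0 : 0 < x := by positivity
  have hx1 : x < 1 := inv_lt_one_of_one_lt₀ hτ
  refine ⟨τ, hτ0, hτ1, (1 - x)⁻¹, ?_, ?_⟩
  · exact (one_le_inv₀ (by linarith)).2 (by linarith)
  intro g e B he hB hd hgB hge
  have hco : ∀ j : ℕ, ‖(j.factorial : ℂ)⁻¹ * iteratedDeriv j g 0‖ ≤ e ^ τ * B ^ (1 - τ) * x ^ j := by
    intro j
    have hdc : ∀ R : ℝ, R < 2 → DiffContOnCl ℂ g (ball 0 R) := by
      intro R hR
      refine DifferentiableOn.diffContOnCl fun z hz => (hd z ?_).differentiableWithinAt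
      have := closure_ball_subset_closedBall hz
      simp only [mem_closedBall, dist_zero_right] at this
      linarith
    have h1 := aux_coeff hr (hdc r (by linarith)) (fun z hz => hge z hz.le) j
    have h2 := aux_coeff (show (0 : ℝ) < 3 / 2 by norm_num) (hdc _ (by norm_num))
      (fun z hz => hgB z (by rw [hz]; norm_num)) j
    set a := ‖(j.factorial : ℂ)⁻¹ * iteratedDeriv j g 0‖
    have ha : 0 ≤ a := norm_nonneg _
    calc a = a ^ τ * a ^ (1 - τ) := by
          rw [← Real.rpow_add_of_nonneg ha hτ0.le (by linarith)]; simp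
      _ ≤ (e / r ^ j) ^ τ * (B / (3 / 2) ^ j) ^ (1 - τ) := by
          gcongr
      _ = _ := by
          rw [Real.div_rpow he.le (by positivity), Real.div_rpow hB.le (by positivity), hx,
            inv_pow, mul_pow, ← Real.rpow_natCast, ← Real.rpow_natCast, ← Real.rpow_natCast,
            ← Real.rpow_natCast, ← Real.rpow_mul hr.le, ← Real.rpow_mul (by norm_num),
            ← Real.rpow_mul hr.le, ← Real.rpow_mul (by norm_num), mul_comm (j : ℝ),
            mul_comm (j : ℝ)]
          field_simp
  have hs := Complex.hasSum_taylorSeries_on_ball (f := g) (c := 0) (r := 2) (z := 1)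
    (fun z hz => (hd z (by simpa using hz)).differentiableWithinAt) (by simp)
  have hgeo := (hasSum_geometric_of_lt_one hx0.le hx1).mul_left (e ^ τ * B ^ (1 - τ))
  have := hs.norm_le_of_bounded hgeo (fun j => by simpa using hco j)
  calc _ ≤ _ := this
    _ = _ := by ring

/-- power sums control the individual terms. -/
theorem aux_powersum {ι : Type*} (s : Finset ι) (z : ι → ℂ) {B a k : ℝ} (hB : 0 < B)
    (h : ∀ n : ℕ, ‖∑ i ∈ s, z i ^ n‖ ≤ (k * n + 1) * (a * B ^ n)) {i₀ : ι} (hi : i₀ ∈ s) :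
    ‖z i₀‖ ≤ B := by
  classical
  by_contra hlt
  push Not at hlt
  set p : Polynomial ℂ := ∏ c ∈ (s.image z).erase (z i₀), (Polynomial.X - Polynomial.C c) with hp
  have hp0 : p.eval (z i₀) ≠ 0 := by
    rw [hp, Polynomial.eval_prod, Finset.prod_ne_zero_iff]
    intro c hc
    simpa [sub_ne_zero] using (Finset.ne_of_mem_erase hc).symm
  have hpz : ∀ i ∈ s, z i ≠ z i₀ → p.eval (z i) = 0 := by
    intro i his hne
    rw [hp, Polynomial.eval_prod]
    exact Finset.prod_eq_zero (i := z i) (Finset.mem_erase.2 ⟨hne, Finset.mem_image_of_mem _ his⟩)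
      (by simp)
  set μ : ℕ := (s.filter (fun i => z i = z i₀)).card with hμ
  have hμ1 : 1 ≤ μ := Finset.card_pos.2 ⟨i₀, by simp [hi]⟩
  have hid : ∀ n : ℕ, (μ : ℂ) * (p.eval (z i₀) * z i₀ ^ n) =
      ∑ l ∈ Finset.range (p.natDegree + 1), p.coeff l * ∑ i ∈ s, z i ^ (n + l) := by
    intro n
    have : ∑ i ∈ s, p.eval (z i) * z i ^ n = (μ : ℂ) * (p.eval (z i₀) * z i₀ ^ n) := by
      rw [hμ, ← nsmul_eq_mul, ← Finset.sum_const, Finset.sum_filter]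
      refine Finset.sum_congr rfl fun i his => ?_
      split_ifs with h
      · rw [h]
      · rw [hpz i his h, zero_mul]
    rw [← this]
    simp_rw [Polynomial.eval_eq_sum_range, Finset.sum_mul, Finset.mul_sum]
    rw [Finset.sum_comm]
    refine Finset.sum_congr rfl fun l _ => Finset.sum_congr rfl fun i _ => ?_
    rw [pow_add]; ring
  have ha : 0 ≤ a := by
    have := (norm_nonneg _).trans (h 0)
    simpa using this
  have hk : 0 ≤ k * a := by
    by_contra hk
    push Not at hk
    obtain ⟨n, hn⟩ := exists_nat_gt (a / (-(k * a)))
    have h1 := (norm_nonneg _).trans (h n)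
    have h2 : 0 ≤ (k * n + 1) * a := by
      have h3 : 0 < B ^ n := by positivity
      refine nonneg_of_mul_nonneg_left (b := B ^ n) ?_ h3
      linarith
    rw [div_lt_iff₀ (by linarith)] at hn
    nlinarith
  set x := B / ‖z i₀‖ with hx
  have hz0 : 0 < ‖z i₀‖ := hB.trans hlt
  have hx0 : 0 < x := by positivity
  have hx1 : x < 1 := (div_lt_one hz0).2 hlt
  set W : ℝ := ∑ l ∈ Finset.range (p.natDegree + 1), ‖p.coeff l‖ * B ^ l with hW
  set d := p.natDegree
  have hbound : ∀ n : ℕ, ‖p.eval (z i₀)‖ ≤ W * ((k * a) * (n * x ^ n) + (k * a * d + a) * x ^ n) := by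
    intro n
    have h1 : ‖p.eval (z i₀) * z i₀ ^ n‖ ≤
        ∑ l ∈ Finset.range (d + 1), ‖p.coeff l‖ * ((k * a * n + (k * a * d + a)) * B ^ (n + l)) := by
      calc ‖p.eval (z i₀) * z i₀ ^ n‖ ≤ (μ : ℝ) * ‖p.eval (z i₀) * z i₀ ^ n‖ := by
            refine le_mul_of_one_le_left (norm_nonneg _) ?_
            exact_mod_cast hμ1
        _ = ‖(μ : ℂ) * (p.eval (z i₀) * z i₀ ^ n)‖ := by simp
        _ ≤ _ := by
            rw [hid n]
            refine norm_sum_le_of_le _ fun l hl => ?_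
            rw [norm_mul]
            refine mul_le_mul_of_nonneg_left ((h (n + l)).trans ?_) (norm_nonneg _)
            have hl' : (l : ℝ) ≤ d := by
              have := Finset.mem_range.1 hl
              exact_mod_cast (by omega : l ≤ d)
            rw [← mul_assoc]
            gcongr
            push_cast
            nlinarith
    have h2 : ∑ l ∈ Finset.range (d + 1), ‖p.coeff l‖ * ((k * a * n + (k * a * d + a)) * B ^ (n + l))
        = W * ((k * a * n + (k * a * d + a)) * B ^ n) := by
      rw [hW, Finset.sum_mul]
      refine Finset.sum_congr rfl fun l _ => ?_
      rw [pow_add]; ring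
    rw [h2, norm_mul, norm_pow] at h1
    have h3 : x ^ n = B ^ n / ‖z i₀‖ ^ n := by rw [hx, div_pow]
    have h4 : ‖p.eval (z i₀)‖ ≤ W * ((k * a * n + (k * a * d + a)) * B ^ n) / ‖z i₀‖ ^ n := by
      rw [le_div_iff₀ (by positivity)]; exact h1
    refine h4.trans (le_of_eq ?_)
    rw [h3]; ring
  have hlim : Tendsto (fun n : ℕ => W * ((k * a) * (n * x ^ n) + (k * a * d + a) * x ^ n)) atTop
      (𝓝 (W * ((k * a) * 0 + (k * a * d + a) * 0))) := by
    have t1 := tendsto_self_mul_const_pow_of_lt_one hx0.le hx1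
    have t2 := tendsto_pow_atTop_nhds_zero_of_lt_one hx0.le hx1
    exact ((t1.const_mul _).add (t2.const_mul _)).const_mul _
  have := ge_of_tendsto hlim (Eventually.of_forall hbound)
  simp only [mul_zero, add_zero] at this
  exact hp0 (norm_le_zero_iff.1 this)


theorem aux_line_zeros {ι : Type*} (D : MvPolynomial ι ℂ) (a v : ι → ℂ)
    {l₀ : ℂ} (h0 : eval (a + l₀ • v) D ≠ 0) :
    ∃ F : Finset ℂ, ∀ l : ℂ, eval (a + l • v) D = 0 ↔ l ∈ F := by
  set p : Polynomial ℂ :=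
    MvPolynomial.aeval (fun i => Polynomial.C (a i) + Polynomial.X * Polynomial.C (v i)) D with hp
  have he : ∀ l : ℂ, p.eval l = eval (a + l • v) D := by
    intro l
    rw [hp, ← Polynomial.coe_evalRingHom, MvPolynomial.aeval_def, MvPolynomial.hom_eval₂]
    rw [MvPolynomial.eval, MvPolynomial.coe_eval₂Hom]
    congr 1
    · ext x <;> simp
    · funext i
      simp only [map_add, map_mul, Polynomial.coe_evalRingHom, Polynomial.eval_C, Polynomial.eval_X,
        Pi.add_apply, Pi.smul_apply, smul_eq_mul]
  have hp0 : p ≠ 0 := by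
    intro h
    apply h0
    rw [← he, h, Polynomial.eval_zero]
  refine ⟨p.roots.toFinset, fun l => ?_⟩
  rw [← he]
  simp [hp0]

theorem aux_exists_ne {ι : Type*} {D : MvPolynomial ι ℂ} (hD : D ≠ 0) : ∃ y, eval y D ≠ 0 := by
  by_contra h
  push Not at h
  exact hD (MvPolynomial.funext (by simpa using h))

theorem aux_multilin_poly {ι : Type*} [Fintype ι] {j : ℕ}
    (p : ContinuousMultilinearMap ℂ (fun _ : Fin j => ι → ℂ) ℂ) (a : ι → ℂ) :
    ∃ q : MvPolynomial ι ℂ, ∀ y, eval y q = p (fun _ => y - a) := by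
  classical
  refine ⟨∑ r : Fin j → ι, C (p (fun i => Pi.single (r i) 1)) * ∏ i, (X (r i) - C (a (r i))),
    fun y => ?_⟩
  have h1 : (y - a) = ∑ i, (y - a) i • (Pi.single i (1 : ℂ) : ι → ℂ) := by
    funext k
    simp [Finset.sum_apply, Pi.single_apply]
  have h2 : p (fun _ => y - a) =
      p.toMultilinearMap (fun _ : Fin j => ∑ i, (y - a) i • (Pi.single i (1 : ℂ) : ι → ℂ)) := by
    rw [← h1]; rfl
  rw [h2, MultilinearMap.map_sum]
  rw [map_sum]
  refine Finset.sum_congr rfl fun r _ => ?_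
  rw [MultilinearMap.map_smul_univ]
  simp [mul_comm]

noncomputable def auxSeries (a : ℕ → ℂ) : FormalMultilinearSeries ℂ ℂ ℂ :=
  fun j => ContinuousMultilinearMap.mkPiRing ℂ (Fin j) (a j)

theorem auxSeries_coeff (a : ℕ → ℂ) (j : ℕ) : (auxSeries a).coeff j = a j := by
  simp [FormalMultilinearSeries.coeff, auxSeries]

theorem aux_multipoly {ι : Type*} [Fintype ι] (Θ : (ι → ℂ) → ℂ) (D : MvPolynomial ι ℂ)
    (hD : D ≠ 0) (han : ∀ y, eval y D ≠ 0 → AnalyticAt ℂ Θ y) {K : ℝ} {n : ℕ}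
    (hb : ∀ y, eval y D ≠ 0 → ‖Θ y‖ ≤ K * (1 + ‖y‖) ^ n) :
    ∃ p : MvPolynomial ι ℂ, ∀ y, eval y D ≠ 0 → Θ y = eval y p := by
  obtain ⟨a, ha⟩ := aux_exists_ne hD
  have hK : 0 ≤ K := by
    have := (norm_nonneg _).trans (hb a ha)
    exact nonneg_of_mul_nonneg_left this (by positivity)
  obtain ⟨P, hP⟩ := han a ha
  choose q hq using fun j : ℕ => aux_multilin_poly (P j) a
  refine ⟨∑ j ∈ Finset.range (n + 1), q j, fun y hy => ?_⟩
  set v := y - a with hv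
  obtain ⟨F, hF⟩ := aux_line_zeros D a v (l₀ := 0) (by simpa using ha)
  set g : ℂ → ℂ := fun l => Θ (a + l • v) with hg
  have hgd : ∀ l, l ∉ F → DifferentiableAt ℂ g l := by
    intro l hl
    have h1 : AnalyticAt ℂ Θ (a + l • v) := han _ (fun h => hl ((hF l).1 h))
    exact h1.differentiableAt.comp l (f := fun l : ℂ => a + l • v) (by fun_prop)
  have hgb : ∀ l, l ∉ F → ‖g l‖ ≤ K * (1 + ‖a‖ + ‖v‖) ^ n * (1 + ‖l‖) ^ n := by
    intro l hl
    refine (hb _ (fun h => hl ((hF l).1 h))).trans ?_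
    rw [mul_assoc, ← mul_pow]
    gcongr
    have h1 := norm_add_le a (l • v)
    rw [norm_smul] at h1
    nlinarith [norm_nonneg a, norm_nonneg v, norm_nonneg l, mul_nonneg (norm_nonneg a) (norm_nonneg l)]
  obtain ⟨c, hc, -⟩ := aux_line F g hgd hgb
  have h1F : (1 : ℂ) ∉ F := by
    rw [← hF, hv]; simpa using hy
  have h0F : (0 : ℂ) ∉ F := by
    rw [← hF]; simpa using ha
  -- the two power series
  have s1 : HasFPowerSeriesAt g
      (auxSeries fun j => P j (fun _ => v)) 0 := by
    rw [hasFPowerSeriesAt_iff]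
    have ht : Tendsto (fun l : ℂ => l • v) (𝓝 0) (𝓝 0) := by
      have : Continuous (fun l : ℂ => l • v) := by fun_prop
      simpa using this.tendsto 0
    filter_upwards [ht.eventually hP.eventually_hasSum] with l hl
    have e : g (0 + l) = Θ (a + l • v) := by simp [hg]
    rw [e]
    convert hl using 1
    funext j
    have := (P j).map_smul_univ (fun _ => l) (fun _ => v)
    simp only [this]
    simp [auxSeries_coeff]
  have s2 : HasFPowerSeriesAt g
      (auxSeries fun j => if j < n + 1 then c j else 0) 0 := by
    rw [hasFPowerSeriesAt_iff]
    have : ((F : Set ℂ)ᶜ) ∈ 𝓝 (0 : ℂ) :=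
      F.finite_toSet.isClosed.isOpen_compl.mem_nhds (by simpa using h0F)
    filter_upwards [this] with l hl
    rw [zero_add, hc l (by simpa using hl)]
    have hs2 := hasSum_sum_of_ne_finset_zero (s := Finset.range (n + 1))
      (L := SummationFilter.unconditional ℕ)
      (f := fun j : ℕ => l ^ j • (if j < n + 1 then c j else 0)) (fun j hj => by
        have : ¬ j < n + 1 := by simpa using hj
        simp [this])
    have e1 : (∑ b ∈ Finset.range (n + 1), l ^ b • (if b < n + 1 then c b else 0))
        = ∑ j ∈ Finset.range (n + 1), c j * l ^ j := by
      refine Finset.sum_congr rfl fun j hj => ?_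
      rw [if_pos (Finset.mem_range.1 hj), smul_eq_mul, mul_comm]
    rw [e1] at hs2
    simp only [auxSeries_coeff]
    exact hs2
  have heq := s1.eq_formalMultilinearSeries s2
  have hco : ∀ j < n + 1, P j (fun _ => v) = c j := by
    intro j hj
    have := congrArg (fun m => FormalMultilinearSeries.coeff m j) heq
    simpa only [auxSeries_coeff, if_pos hj] using this
  have hy' : Θ y = g 1 := by simp [hg, hv]
  rw [hy', hc 1 h1F, map_sum]
  refine Finset.sum_congr rfl fun j hj => ?_
  rw [hq, one_pow, mul_one, hco j (Finset.mem_range.1 hj)]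


noncomputable def auxPhi {M m : ℕ} (B : Set (Fin M → ℂ)) (π : (Fin M → ℂ) →ₗ[ℂ] (Fin m → ℂ)) :
    MvPolynomial (Fin m) ℂ →ₐ[ℂ] (B → ℂ) :=
  MvPolynomial.aeval (fun i (w : B) => π w i)

theorem auxPhi_apply {M m : ℕ} (B : Set (Fin M → ℂ)) (π : (Fin M → ℂ) →ₗ[ℂ] (Fin m → ℂ))
    (p : MvPolynomial (Fin m) ℂ) (w : B) : auxPhi B π p w = eval (π w) p := by
  induction p using MvPolynomial.induction_on with
  | C a => simp [auxPhi]
  | add p q hp hq => simp [hp, hq]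
  | mul_X p i hp => rw [map_mul, Pi.mul_apply, hp]; simp [auxPhi]

/-- substitution along a line -/
noncomputable def auxSub {m n : ℕ} (a : Fin n → MvPolynomial (Fin m) ℂ) (v : Fin n → ℂ) :
    MvPolynomial (Fin n) ℂ →ₐ[ℂ] Polynomial (MvPolynomial (Fin m) ℂ) :=
  MvPolynomial.aeval (fun i => Polynomial.C (a i) + Polynomial.C (C (v i)) * Polynomial.X)

theorem auxSub_eval {m n : ℕ} (a : Fin n → MvPolynomial (Fin m) ℂ) (v : Fin n → ℂ)
    (p : MvPolynomial (Fin n) ℂ) (y : Fin m → ℂ) (t : ℂ) :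
    (auxSub a v p).eval₂ (eval y) t = eval (fun i => eval y (a i) + t * v i) p := by
  induction p using MvPolynomial.induction_on with
  | C a => simp [auxSub, Polynomial.algebraMap_apply]
  | add p q hp hq => simp [Polynomial.eval₂_add, hp, hq]
  | mul_X p i hp =>
    rw [map_mul, Polynomial.eval₂_mul, hp]
    simp only [auxSub, aeval_X, Polynomial.eval₂_add, Polynomial.eval₂_mul, Polynomial.eval₂_C,
      Polynomial.eval₂_X, map_mul, eval_X, eval_C, mul_comm t]

theorem aux_coeff_prod {ι R : Type*} [CommRing R] (s : Finset ι) (f : ι → Polynomial R) (d : ι → ℕ)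
    (h : ∀ i ∈ s, (f i).natDegree ≤ d i) :
    (∏ i ∈ s, f i).coeff (∑ i ∈ s, d i) = ∏ i ∈ s, (f i).coeff (d i) := by
  classical
  induction s using Finset.induction_on with
  | empty => simp
  | insert a s ha ih =>
    rw [Finset.prod_insert ha, Finset.sum_insert ha, Finset.prod_insert ha,
      Polynomial.coeff_mul_add_eq_of_natDegree_le (h a (by simp)),
      ih (fun i hi => h i (by simp [hi]))]
    refine (Polynomial.natDegree_prod_le _ _).trans (Finset.sum_le_sum fun i hi => h i (by simp [hi]))

theorem auxSub_deg {m n : ℕ} (a : Fin n → MvPolynomial (Fin m) ℂ) (v : Fin n → ℂ)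
    (s : Fin n →₀ ℕ) (x : ℂ) :
    (auxSub a v (monomial s x)).natDegree ≤ s.degree ∧
    (auxSub a v (monomial s x)).coeff s.degree = C (eval v (monomial s x)) := by
  have h : auxSub a v (monomial s x) = Polynomial.C (C x) *
      ∏ i, (Polynomial.C (a i) + Polynomial.C (C (v i)) * Polynomial.X) ^ s i := by
    rw [auxSub, MvPolynomial.aeval_monomial, Finsupp.prod_fintype _ _ (by simp)]
    rfl
  have hd : ∀ i, (Polynomial.C (a i) + Polynomial.C (C (v i)) * Polynomial.X :
      Polynomial (MvPolynomial (Fin m) ℂ)).natDegree ≤ 1 := by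
    intro i
    compute_degree
  have hdp : ∀ i ∈ Finset.univ, ((Polynomial.C (a i) + Polynomial.C (C (v i)) * Polynomial.X :
      Polynomial (MvPolynomial (Fin m) ℂ)) ^ s i).natDegree ≤ s i := by
    intro i _
    have := Polynomial.natDegree_pow_le_of_le (s i) (hd i)
    simpa using this
  have hs : s.degree = ∑ i, s i := by
    rw [Finsupp.degree_eq_sum]
  rw [h, hs]
  constructor
  · refine (Polynomial.natDegree_C_mul_le _ _).trans ?_
    refine (Polynomial.natDegree_prod_le _ _).trans (Finset.sum_le_sum fun i hi => hdp i hi)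
  · rw [Polynomial.coeff_C_mul]
    rw [aux_coeff_prod _ _ _ hdp, eval_monomial, Finsupp.prod_fintype _ _ (by simp)]
    rw [map_mul, map_prod]
    congr 1
    refine Finset.prod_congr rfl fun i _ => ?_
    have := Polynomial.coeff_pow_of_natDegree_le (m := s i) (hd i)
    rw [mul_one] at this
    rw [this]
    simp

theorem auxSub_top {m n : ℕ} (a : Fin n → MvPolynomial (Fin m) ℂ) (v : Fin n → ℂ)
    (F : MvPolynomial (Fin n) ℂ) :
    (auxSub a v F).natDegree ≤ F.totalDegree ∧
    (auxSub a v F).coeff F.totalDegree = C (eval v (homogeneousComponent F.totalDegree F)) := by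
  have hF : auxSub a v F = ∑ s ∈ F.support, auxSub a v (monomial s (coeff s F)) := by
    rw [← map_sum, ← F.as_sum]
  constructor
  · rw [hF]
    refine Polynomial.natDegree_sum_le_of_forall_le _ _ fun s hs => ?_
    exact (auxSub_deg a v s _).1.trans (le_totalDegree hs)
  · rw [homogeneousComponent_apply, map_sum, map_sum, hF, Polynomial.finsetSum_coeff,
      Finset.sum_filter]
    refine Finset.sum_congr rfl fun s hs => ?_
    split_ifs with h
    · rw [← h]; exact (auxSub_deg a v s _).2
    · apply Polynomial.coeff_eq_zero_of_natDegree_lt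
      refine (auxSub_deg a v s _).1.trans_lt (lt_of_le_of_ne (le_totalDegree hs) h)

/-- growth along zero sets -/
theorem aux_growth {n : ℕ} (F : MvPolynomial (Fin n) ℂ) (v : Fin n → ℂ)
    (hv : eval v (homogeneousComponent F.totalDegree F) ≠ 0) :
    ∃ C : ℝ, 0 ≤ C ∧ ∀ (a : Fin n → ℂ) (t : ℂ), eval (a + t • v) F = 0 → ‖t‖ ≤ C * (1 + ‖a‖) := by
  set D := F.totalDegree with hD
  have hcont : ∀ p : MvPolynomial (Fin n) ℂ, Continuous (fun z : Fin n → ℂ => eval z p) :=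
    fun p => MvPolynomial.continuous_eval p
  set η := ‖eval v (homogeneousComponent D F)‖ / 2 with hη
  have hη0 : 0 < η := by positivity
  have h1 : ∀ᶠ z in 𝓝 v, η < ‖eval z (homogeneousComponent D F)‖ := by
    refine (hcont _).norm.continuousAt.eventually (lt_mem_nhds ?_)
    rw [hη]; linarith
  obtain ⟨ε, hε, hball⟩ := Metric.eventually_nhds_iff_ball.1 h1
  obtain ⟨A, hA⟩ := (isCompact_closedBall v ε).exists_bound_of_continuousOn
    (f := fun z => ∑ d ∈ Finset.range D, ‖eval z (homogeneousComponent d F)‖)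
    (by
      apply Continuous.continuousOn
      exact continuous_finsetSum _ fun d _ => (hcont _).norm)
  have hA0 : 0 ≤ A := (norm_nonneg _).trans (hA v (by simp [hε.le]))
  refine ⟨1 + A / η + 1 / ε, by positivity, fun a t h0 => ?_⟩
  by_contra hlt
  push Not at hlt
  have ha := norm_nonneg a
  have hexp : (1 + A / η + 1 / ε) * (1 + ‖a‖) = 1 + A / η + 1 / ε * ‖a‖ +
    (1/ε + ‖a‖ + A / η * ‖a‖) := by ring
  have p1 : 0 ≤ A / η := by positivity
  have p2 : 0 ≤ 1 / ε * ‖a‖ := by positivity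
  have p3 : 0 ≤ 1/ε + ‖a‖ + A / η * ‖a‖ := by positivity
  have ht1 : 1 < ‖t‖ := by
    have : 0 < 1 / ε := by positivity
    nlinarith
  have htA : A < ‖t‖ * η := by
    rw [← div_lt_iff₀ hη0]; linarith
  have hta : ‖a‖ < ε * ‖t‖ := by
    have : 1 / ε * ‖a‖ < ‖t‖ := by linarith
    rw [one_div, inv_mul_lt_iff₀ hε] at this
    exact this
  have ht0 : t ≠ 0 := by
    rintro rfl
    simp at ht1
    linarith
  set z : Fin n → ℂ := t⁻¹ • a + v with hz
  have hzb : z ∈ ball v ε := by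
    rw [mem_ball, dist_eq_norm, hz, add_sub_cancel_right, norm_smul, norm_inv,
      inv_mul_lt_iff₀ (by linarith), mul_comm]
    exact hta
  have hat : a + t • v = t • z := by
    rw [hz, smul_add, smul_smul, mul_inv_cancel₀ ht0, one_smul]
  have hhom : ∀ d, eval (t • z) (homogeneousComponent d F) = t ^ d * eval z (homogeneousComponent d F) := by
    intro d
    rw [homogeneousComponent_apply, map_sum, map_sum, Finset.mul_sum]
    refine Finset.sum_congr rfl fun s hs => ?_
    have hs' : s.degree = d := (Finset.mem_filter.1 hs).2
    rw [eval_monomial, eval_monomial, Finsupp.prod_fintype _ _ (by simp),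
      Finsupp.prod_fintype _ _ (by simp), ← hs', Finsupp.degree_eq_sum, ← Finset.prod_pow_eq_pow_sum]
    simp only [Pi.smul_apply, smul_eq_mul, mul_pow, Finset.prod_mul_distrib]
    ring
  have hsum : eval (t • z) F = ∑ d ∈ Finset.range (D + 1), t ^ d * eval z (homogeneousComponent d F) := by
    conv_lhs => rw [← sum_homogeneousComponent F]
    rw [map_sum]
    exact Finset.sum_congr rfl fun d _ => hhom d
  rw [hat, hsum, Finset.sum_range_succ] at h0
  have h2 : ‖t ^ D * eval z (homogeneousComponent D F)‖ ≤ ‖t‖ ^ D * (A / ‖t‖) := by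
    rw [add_eq_zero_iff_eq_neg'] at h0
    rw [h0, norm_neg]
    refine (norm_sum_le _ _).trans ?_
    have : ∀ d ∈ Finset.range D, ‖t ^ d * eval z (homogeneousComponent d F)‖ ≤
        ‖t‖ ^ D / ‖t‖ * ‖eval z (homogeneousComponent d F)‖ := by
      intro d hd
      rw [norm_mul, norm_pow]
      gcongr
      rw [le_div_iff₀ (by linarith), ← pow_succ]
      exact pow_le_pow_right₀ ht1.le (by simpa using hd)
    refine (Finset.sum_le_sum this).trans ?_
    rw [← Finset.mul_sum, div_mul_eq_mul_div, ← mul_div_assoc]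
    gcongr
    exact (le_abs_self _).trans (hA z (ball_subset_closedBall hzb))
  rw [norm_mul, norm_pow] at h2
  have h3 := le_of_mul_le_mul_left h2 (by positivity)
  have h4 := hball z hzb
  rw [le_div_iff₀ (by linarith)] at h3
  nlinarith


def AuxNoe {M m : ℕ} (B : Set (Fin M → ℂ)) (π : (Fin M → ℂ) →ₗ[ℂ] (Fin m → ℂ)) : Prop :=
  (∃ C : ℝ, ∀ w ∈ B, ‖w‖ ≤ C * (1 + ‖π w‖)) ∧
  ∀ j, (auxPhi B π).toRingHom.IsIntegralElem (fun w : B => w.1 j)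

theorem aux_noether_step {M m : ℕ} (B : Set (Fin M → ℂ)) (hne : B.Nonempty)
    (π : (Fin M → ℂ) →ₗ[ℂ] (Fin (m + 1) → ℂ)) (h : AuxNoe B π)
    (F : MvPolynomial (Fin (m + 1)) ℂ) (hF : F ≠ 0) (hF0 : ∀ w ∈ B, eval (π w) F = 0) :
    ∃ π' : (Fin M → ℂ) →ₗ[ℂ] (Fin m → ℂ), AuxNoe B π' := by
  classical
  set Ft := homogeneousComponent F.totalDegree F with hFt
  have hFt0 : Ft ≠ 0 := by
    obtain ⟨s, hs, hsd⟩ : ∃ s ∈ F.support, s.degree = F.totalDegree := by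
      obtain ⟨s, hs, h1⟩ := Finset.exists_mem_eq_sup F.support (by simpa using hF)
        (fun s => s.sum fun _ e => e)
      exact ⟨s, hs, h1.symm⟩
    intro h0
    have := coeff_homogeneousComponent F.totalDegree F s
    rw [← hFt, h0, if_pos hsd] at this
    simp at this
    exact (mem_support_iff.1 hs) this.symm
  obtain ⟨v, hv⟩ := aux_exists_ne hFt0
  have hdeg : F.totalDegree ≠ 0 := by
    intro h0
    obtain ⟨w, hw⟩ := hne
    rw [totalDegree_eq_zero_iff_eq_C] at h0
    have := hF0 w hw
    rw [h0, eval_C] at this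
    rw [this, C_0] at h0
    exact hF h0
  have hvne : v ≠ 0 := by
    intro h0
    apply hv
    rw [h0, hFt, homogeneousComponent_apply, map_sum]
    refine Finset.sum_eq_zero fun s hs => ?_
    have hs' := (Finset.mem_filter.1 hs).2
    have : ∃ i, s i ≠ 0 := by
      by_contra hcon
      push Not at hcon
      apply hdeg
      rw [← hs', Finsupp.degree_eq_sum]
      simp [hcon]
    obtain ⟨i, hi⟩ := this
    rw [eval_monomial, Finsupp.prod_fintype _ _ (by simp)]
    rw [Finset.prod_eq_zero (Finset.mem_univ i) (by simp [hi]), mul_zero]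
  obtain ⟨i₀, hi₀⟩ : ∃ i, v i ≠ 0 := by
    by_contra hcon
    push Not at hcon
    exact hvne (funext hcon)
  let ρ : (Fin (m + 1) → ℂ) →ₗ[ℂ] (Fin m → ℂ) :=
    { toFun := fun y j => y (i₀.succAbove j) - v (i₀.succAbove j) / v i₀ * y i₀
      map_add' := by intro x y; funext j; simp; ring
      map_smul' := by intro x y; funext j; simp; ring }
  have hdec : ∀ y : Fin (m + 1) → ℂ,
      y = (i₀.insertNth (α := fun _ => ℂ) 0 (ρ y)) + (y i₀ / v i₀) • v := by
    intro y
    funext i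
    refine Fin.succAboveCases i₀ ?_ (fun j => ?_) i
    · simp [hi₀]
    · simp [ρ]; field_simp; ring
  have hins : ∀ z : Fin m → ℂ, ‖(i₀.insertNth (α := fun _ => ℂ) 0 z)‖ ≤ ‖z‖ := by
    intro z
    rw [pi_norm_le_iff_of_nonneg (norm_nonneg _)]
    intro i
    refine Fin.succAboveCases i₀ ?_ (fun j => ?_) i
    · simp
    · simpa using norm_le_pi_norm z j
  obtain ⟨C0, hC0, hgr⟩ := aux_growth F v hv
  obtain ⟨⟨C1, hC1⟩, hint⟩ := h
  have hyb : ∀ w ∈ B, ‖π w‖ ≤ (1 + C0 * ‖v‖) * (1 + ‖ρ (π w)‖) := by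
    intro w hw
    have h1 := hdec (π w)
    have h2 := hgr _ _ (by rw [← h1]; exact hF0 w hw)
    have h3 := hins (ρ (π w))
    have h4 := norm_add_le (i₀.insertNth (α := fun _ => ℂ) 0 (ρ (π w))) ((π w i₀ / v i₀) • v)
    rw [← h1] at h4
    rw [norm_smul] at h4
    have h5 : ‖π w i₀ / v i₀‖ * ‖v‖ ≤ C0 * (1 + ‖ρ (π w)‖) * ‖v‖ := by
      gcongr
      refine h2.trans ?_
      gcongr
    nlinarith [norm_nonneg v]
  refine ⟨ρ.comp π, ⟨|C1| * (2 + C0 * ‖v‖), fun w hw => ?_⟩, ?_⟩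
  · have h1 := hyb w hw
    have h2 := hC1 w hw
    have h3 : ‖w‖ ≤ |C1| * (1 + ‖π w‖) := h2.trans (by gcongr; exact le_abs_self _)
    refine h3.trans ?_
    rw [mul_assoc]
    gcongr
    simp only [LinearMap.comp_apply]
    nlinarith [norm_nonneg (ρ (π w))]
  · let _ : Algebra (MvPolynomial (Fin m) ℂ) (B → ℂ) := (auxPhi B (ρ.comp π)).toRingHom.toAlgebra
    have halg : ∀ p, algebraMap (MvPolynomial (Fin m) ℂ) (B → ℂ) p = auxPhi B (ρ.comp π) p :=
      fun p => rfl
    set Cl := integralClosure (MvPolynomial (Fin m) ℂ) (B → ℂ) with hCl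
    have hmem : ∀ p, algebraMap (MvPolynomial (Fin m) ℂ) (B → ℂ) p ∈ Cl := fun p =>
      Cl.algebraMap_mem p
    have hconst : ∀ z : ℂ, (fun _ : B => z) ∈ Cl := by
      intro z
      have := hmem (C z)
      convert this using 1
      funext w
      rw [halg, auxPhi_apply, eval_C]
    have hcoord : ∀ j, (fun w : B => ρ (π w) j) ∈ Cl := by
      intro j
      have := hmem (X j)
      convert this using 1
      funext w
      rw [halg, auxPhi_apply, eval_X, LinearMap.comp_apply]
    -- t is integral
    have htint : (fun w : B => π w i₀ / v i₀) ∈ Cl := by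
      rw [hCl, mem_integralClosure_iff]
      set a : Fin (m + 1) → MvPolynomial (Fin m) ℂ :=
        i₀.insertNth (α := fun _ => MvPolynomial (Fin m) ℂ) 0 (fun j => X j) with ha
      obtain ⟨hd1, hd2⟩ := auxSub_top a v F
      refine ⟨Polynomial.C (C (eval v Ft)⁻¹) * auxSub a v F, ?_, ?_⟩
      · refine Polynomial.monic_of_natDegree_le_of_coeff_eq_one F.totalDegree
          ((Polynomial.natDegree_C_mul_le _ _).trans hd1) ?_
        rw [Polynomial.coeff_C_mul, hd2, ← C_mul, inv_mul_cancel₀ hv, C_1]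
      · rw [Polynomial.eval₂_mul]
        have : Polynomial.eval₂ (algebraMap (MvPolynomial (Fin m) ℂ) (B → ℂ))
            (fun w : B => π w i₀ / v i₀) (auxSub a v F) = 0 := by
          funext w
          have e := Polynomial.hom_eval₂ (auxSub a v F) (algebraMap (MvPolynomial (Fin m) ℂ) (B → ℂ))
            (Pi.evalRingHom (fun _ : B => ℂ) w) (fun w : B => π w i₀ / v i₀)
          have e2 : (Pi.evalRingHom (fun _ : B => ℂ) w).comp
              (algebraMap (MvPolynomial (Fin m) ℂ) (B → ℂ)) = eval (ρ (π w)) := by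
            refine RingHom.ext fun p => ?_
            rw [RingHom.comp_apply, halg]
            simp [auxPhi_apply]
          rw [e2, auxSub_eval] at e
          refine Eq.trans e ?_
          have h1 := hF0 w w.2
          rw [hdec (π w)] at h1
          convert h1 using 3
          funext i
          refine Fin.succAboveCases i₀ ?_ (fun j => ?_) i
          · simp [ha]
          · simp [ha]
          · rfl
        rw [this, mul_zero]
    have hpi : ∀ i, (fun w : B => π w i) ∈ Cl := by
      intro i
      have e : (fun w : B => π w i) =
          (fun w : B => (i₀.insertNth (α := fun _ => ℂ) 0 (ρ (π w))) i) +
          (fun w : B => π w i₀ / v i₀) * (fun _ : B => v i) := by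
        funext w
        conv_lhs => rw [hdec (π w)]
        simp
      rw [e]
      refine Cl.add_mem ?_ (Cl.mul_mem htint (hconst _))
      refine Fin.succAboveCases i₀ ?_ (fun j => ?_) i
      · simpa using hconst 0
      · simpa using hcoord j
    have hphi : ∀ p, auxPhi B π p ∈ Cl := by
      intro p
      induction p using MvPolynomial.induction_on with
      | C a =>
        convert hconst a using 1
        funext w
        rw [auxPhi_apply, eval_C]
      | add p q hp hq => rw [map_add]; exact Cl.add_mem hp hq
      | mul_X p i hp =>
        rw [map_mul]
        refine Cl.mul_mem hp ?_
        convert hpi i using 1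
        funext w
        rw [auxPhi_apply, eval_X]
    let ψ : MvPolynomial (Fin (m + 1)) ℂ →+* Cl :=
      RingHom.codRestrict (auxPhi B π).toRingHom Cl hphi
    intro j
    have hx : IsIntegral Cl (fun w : B => w.1 j) := by
      obtain ⟨p, hp, hp0⟩ := hint j
      refine ⟨p.map ψ, hp.map ψ, ?_⟩
      rw [Polynomial.eval₂_map]
      exact hp0
    have := isIntegral_trans (R := MvPolynomial (Fin m) ℂ) (A := Cl) _ hx
    exact this

theorem aux_noether {M : ℕ} (B : Set (Fin M → ℂ)) (hne : B.Nonempty) : ∀ (m : ℕ)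
    (π : (Fin M → ℂ) →ₗ[ℂ] (Fin m → ℂ)), AuxNoe B π →
    ∃ (m' : ℕ) (π' : (Fin M → ℂ) →ₗ[ℂ] (Fin m' → ℂ)), AuxNoe B π' ∧
      ∀ F : MvPolynomial (Fin m') ℂ, F ≠ 0 → ∃ w ∈ B, eval (π' w) F ≠ 0 := by
  intro m
  induction m with
  | zero =>
    intro π h
    refine ⟨0, π, h, fun F hF => ?_⟩
    obtain ⟨w, hw⟩ := hne
    obtain ⟨y, hy⟩ := aux_exists_ne hF
    exact ⟨w, hw, by rwa [Subsingleton.elim (π w) y]⟩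
  | succ m ih =>
    intro π h
    by_cases hF : ∀ F : MvPolynomial (Fin (m + 1)) ℂ, F ≠ 0 → ∃ w ∈ B, eval (π w) F ≠ 0
    · exact ⟨m + 1, π, h, hF⟩
    · push Not at hF
      obtain ⟨F, hF, hF0⟩ := hF
      obtain ⟨π', h'⟩ := aux_noether_step B hne π h F hF hF0
      exact ih π' h'

theorem aux_noether_all {M : ℕ} (B : Set (Fin M → ℂ)) (hne : B.Nonempty) :
    ∃ (m : ℕ) (π : (Fin M → ℂ) →ₗ[ℂ] (Fin m → ℂ)), AuxNoe B π ∧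
      ∀ F : MvPolynomial (Fin m) ℂ, F ≠ 0 → ∃ w ∈ B, eval (π w) F ≠ 0 := by
  refine aux_noether B hne M LinearMap.id ⟨⟨1, fun w _ => ?_⟩, fun j => ?_⟩
  · simp
  · have : (fun w : B => w.1 j) = auxPhi B LinearMap.id (X j) := by
      funext w
      rw [auxPhi_apply]
      simp
    rw [this]
    exact RingHom.isIntegralElem_map _


theorem aux_clear {S K : Type*} [CommRing S] [IsDomain S] [Field K] [Algebra S K] [IsFractionRing S K]
    (p : Polynomial K) : ∃ d : S, d ≠ 0 ∧ ∃ q : Polynomial S,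
      q.map (algebraMap S K) = Polynomial.C (algebraMap S K d) * p := by
  obtain ⟨b, hbM, hb⟩ := IsLocalization.integerNormalization_spec (nonZeroDivisors S) p
  refine ⟨b, nonZeroDivisors.ne_zero hbM, _, hb.trans ?_⟩
  rw [Algebra.smul_def]
  rfl

theorem aux_primitive0 {M : ℕ} {S R K L : Type} [CommRing S] [IsDomain S] [IsIntegrallyClosed S] [CharZero S]
    [Algebra ℂ S] [CommRing R] [IsDomain R] [Algebra ℂ R] [Algebra S R] [IsScalarTower ℂ S R]
    [Algebra.IsIntegral S R]
    [Field K] [Algebra S K] [IsFractionRing S K] [Field L] [Algebra R L] [IsFractionRing R L]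
    [Algebra S L] [IsScalarTower S R L] [Algebra K L] [IsScalarTower S K L] [FaithfulSMul S R]
    (x : Fin M → R) (hx : Algebra.adjoin ℂ (Set.range x) = ⊤) :
    ∃ (u : R) (P : Polynomial S), P.Monic ∧ Polynomial.aeval u P = 0 ∧
      (∀ p : Polynomial S, Polynomial.aeval u p = 0 → P ∣ p) ∧
      (∃ D : S, D ≠ 0 ∧ ∃ A B : Polynomial S, A * P + B * Polynomial.derivative P = Polynomial.C D) ∧
      ∃ (D : S) (c : Fin M → Polynomial S), D ≠ 0 ∧
        ∀ i, algebraMap S R D * x i = Polynomial.aeval u (c i) := by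
  have hinjK : Function.Injective (algebraMap S K) := IsFractionRing.injective S K
  have hinjL : Function.Injective (algebraMap R L) := IsFractionRing.injective R L
  have hcharK : CharZero K := charZero_of_injective_algebraMap hinjK
  have hSL : ∀ s : S, algebraMap R L (algebraMap S R s) = algebraMap K L (algebraMap S K s) := by
    intro s
    rw [← IsScalarTower.algebraMap_apply, ← IsScalarTower.algebraMap_apply]
  have hgenR : ∀ (E : IntermediateField K L), (∀ i, algebraMap R L (x i) ∈ E) →
      ∀ r : R, algebraMap R L r ∈ E := by
    intro E hE r
    have hr : r ∈ Algebra.adjoin ℂ (Set.range x) := by rw [hx]; trivial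
    induction hr using Algebra.adjoin_induction with
    | mem r hr => obtain ⟨i, rfl⟩ := hr; exact hE i
    | algebraMap z =>
      rw [IsScalarTower.algebraMap_apply ℂ S R, hSL]
      exact E.algebraMap_mem _
    | add a b _ _ ha hb => rw [map_add]; exact E.add_mem ha hb
    | mul a b _ _ ha hb => rw [map_mul]; exact E.mul_mem ha hb
  have hgen : ∀ (E : IntermediateField K L), (∀ i, algebraMap R L (x i) ∈ E) → E = ⊤ := by
    intro E hE
    rw [eq_top_iff]
    intro l _
    obtain ⟨a, b, hb, rfl⟩ := IsFractionRing.div_surjective (A := R) l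
    exact E.div_mem (hgenR E hE a) (hgenR E hE b)
  have hint : ∀ r : R, IsIntegral K (algebraMap R L r) := by
    intro r
    have h1 : IsIntegral S r := Algebra.IsIntegral.isIntegral r
    have h2 : IsIntegral S (algebraMap R L r) := h1.map (IsScalarTower.toAlgHom S R L)
    exact h2.tower_top
  have hfd : FiniteDimensional K L := by
    have h1 : IntermediateField.adjoin K (Set.range (fun i => algebraMap R L (x i))) = ⊤ :=
      hgen _ (fun i => IntermediateField.subset_adjoin _ _ ⟨i, rfl⟩)
    have h2 : FiniteDimensional K
        (IntermediateField.adjoin K (Set.range (fun i => algebraMap R L (x i)))) := by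
      apply IntermediateField.finiteDimensional_adjoin
      rintro _ ⟨i, rfl⟩
      exact hint _
    rw [h1] at h2
    exact IntermediateField.topEquiv.toLinearEquiv.finiteDimensional
  have hfin : Finite (IntermediateField K L) :=
    Field.finite_intermediateField_of_exists_primitive_element K L (Field.exists_primitive_element K L)
  let sub : {E : IntermediateField K L // E ≠ ⊤} → Submodule ℂ R := fun E =>
    { carrier := {r | algebraMap R L r ∈ E.1}
      add_mem' := fun {a b} ha hb => by
        change algebraMap R L (a + b) ∈ E.1
        rw [map_add]; exact E.1.add_mem ha hb
      zero_mem' := by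
        change algebraMap R L 0 ∈ E.1
        rw [map_zero]; exact E.1.zero_mem
      smul_mem' := fun z r hr => by
        change algebraMap R L (z • r) ∈ E.1
        rw [Algebra.smul_def, IsScalarTower.algebraMap_apply ℂ S R, map_mul, hSL]
        exact E.1.mul_mem (E.1.algebraMap_mem _) hr }
  obtain ⟨u, hu⟩ : ∃ u : R, ∀ E : {E : IntermediateField K L // E ≠ ⊤}, u ∉ sub E := by
    by_contra hcon
    push Not at hcon
    obtain ⟨E, hE⟩ := Subspace.exists_eq_top_of_iUnion_eq_univ (p := sub)
      (by
        rw [Set.eq_univ_iff_forall]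
        intro r
        obtain ⟨E, hE⟩ := hcon r
        exact Set.mem_iUnion.2 ⟨E, hE⟩)
    refine E.2 (hgen E.1 fun i => ?_)
    have : x i ∈ sub E := by rw [hE]; trivial
    exact this
  have htop : IntermediateField.adjoin K {algebraMap R L u} = ⊤ := by
    by_contra hne
    exact hu ⟨_, hne⟩ (IntermediateField.mem_adjoin_simple_self K _)
  have hui : IsIntegral S u := Algebra.IsIntegral.isIntegral u
  have hmin : minpoly K (algebraMap R L u) = (minpoly S u).map (algebraMap S K) :=
    minpoly.isIntegrallyClosed_eq_field_fractions K L hui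
  refine ⟨u, minpoly S u, minpoly.monic hui, minpoly.aeval S u,
    fun p hp => minpoly.isIntegrallyClosed_dvd hui hp, ?_, ?_⟩
  · have hsep : (minpoly K (algebraMap R L u)).Separable :=
      (minpoly.irreducible (hint u)).separable
    obtain ⟨a, b, hab⟩ := hsep
    obtain ⟨d1, hd1, a', ha'⟩ := aux_clear (S := S) a
    obtain ⟨d2, hd2, b', hb'⟩ := aux_clear (S := S) b
    refine ⟨d1 * d2, mul_ne_zero hd1 hd2, Polynomial.C d2 * a', Polynomial.C d1 * b', ?_⟩
    apply Polynomial.map_injective _ hinjK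
    rw [hmin, Polynomial.derivative_map] at hab
    simp only [Polynomial.map_add, Polynomial.map_mul, Polynomial.map_C, ha', hb', map_mul]
    linear_combination (Polynomial.C (algebraMap S K d1) * Polynomial.C (algebraMap S K d2)) * hab
  · have h1 : ∀ i, ∃ (d : S) (q : Polynomial S), d ≠ 0 ∧
        algebraMap S R d * x i = Polynomial.aeval u q := by
      intro i
      have hmem : algebraMap R L (x i) ∈ IntermediateField.adjoin K {algebraMap R L u} := by
        rw [htop]; trivial
      have hmem' : algebraMap R L (x i) ∈ Algebra.adjoin K {algebraMap R L u} := by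
        rw [← IntermediateField.adjoin_simple_toSubalgebra_of_isAlgebraic (hint u).isAlgebraic]
        exact hmem
      rw [Algebra.adjoin_singleton_eq_range_aeval] at hmem'
      obtain ⟨p, hp⟩ := hmem'
      obtain ⟨d, hd, q, hq⟩ := aux_clear (S := S) p
      refine ⟨d, q, hd, hinjL ?_⟩
      rw [map_mul, hSL, ← Polynomial.aeval_algebraMap_apply, ← Polynomial.aeval_map_algebraMap K, hq,
        map_mul, Polynomial.aeval_C]
      congr 1
      exact hp.symm
    choose d q hd hq using h1
    refine ⟨∏ i, d i, fun i => Polynomial.C (∏ j ∈ Finset.univ.erase i, d j) * q i,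
      Finset.prod_ne_zero_iff.2 fun i _ => hd i, fun i => ?_⟩
    rw [map_mul, Polynomial.aeval_C, ← hq, ← mul_assoc, ← map_mul,
      Finset.prod_erase_mul _ _ (Finset.mem_univ i)]

theorem aux_primitive {M : ℕ} {S R : Type} [CommRing S] [IsDomain S] [IsIntegrallyClosed S] [CharZero S]
    [Algebra ℂ S] [CommRing R] [IsDomain R] [Algebra ℂ R] [Algebra S R] [IsScalarTower ℂ S R]
    [Algebra.IsIntegral S R] [FaithfulSMul S R]
    (x : Fin M → R) (hx : Algebra.adjoin ℂ (Set.range x) = ⊤) :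
    ∃ (u : R) (P : Polynomial S), P.Monic ∧ Polynomial.aeval u P = 0 ∧
      (∀ p : Polynomial S, Polynomial.aeval u p = 0 → P ∣ p) ∧
      (∃ D : S, D ≠ 0 ∧ ∃ A B : Polynomial S, A * P + B * Polynomial.derivative P = Polynomial.C D) ∧
      ∃ (D : S) (c : Fin M → Polynomial S), D ≠ 0 ∧
        ∀ i, algebraMap S R D * x i = Polynomial.aeval u (c i) := by
  let _ : Algebra (FractionRing S) (FractionRing R) := FractionRing.liftAlgebra S (FractionRing R)
  exact aux_primitive0 (K := FractionRing S) (L := FractionRing R) x hx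


theorem aux_homog {M m : ℕ} (D : MvPolynomial (Fin m) ℂ)
    (c : Fin M → Polynomial (MvPolynomial (Fin m) ℂ)) (p : MvPolynomial (Fin M) ℂ) :
    ∃ (e : ℕ) (q : Polynomial (MvPolynomial (Fin m) ℂ)), ∀ (y : Fin m → ℂ) (t : ℂ) (z : Fin M → ℂ),
      (∀ i, eval y D * z i = (c i).eval₂ (eval y) t) →
      q.eval₂ (eval y) t = (eval y D) ^ e * eval z p := by
  induction p using MvPolynomial.induction_on with
  | C a => exact ⟨0, Polynomial.C (C a), fun y t z _ => by simp⟩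
  | add p q hp hq =>
    obtain ⟨e1, q1, h1⟩ := hp
    obtain ⟨e2, q2, h2⟩ := hq
    refine ⟨e1 + e2, Polynomial.C (D ^ e2) * q1 + Polynomial.C (D ^ e1) * q2, fun y t z h => ?_⟩
    rw [Polynomial.eval₂_add, Polynomial.eval₂_mul, Polynomial.eval₂_mul, h1 y t z h, h2 y t z h]
    rw [Polynomial.eval₂_C, Polynomial.eval₂_C, map_pow, map_pow, map_add]
    ring
  | mul_X p i hp =>
    obtain ⟨e1, q1, h1⟩ := hp
    refine ⟨e1 + 1, q1 * c i, fun y t z h => ?_⟩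
    rw [Polynomial.eval₂_mul, h1 y t z h, ← h i]
    simp only [map_mul, eval_X]
    ring

/-- Data presenting an irreducible algebraic set as a branched cover. -/
structure AuxCov {M : ℕ} (B : Set (Fin M → ℂ)) where
  m : ℕ
  π : (Fin M → ℂ) →ₗ[ℂ] (Fin m → ℂ)
  Cπ : ℝ
  growth : ∀ w ∈ B, ‖w‖ ≤ Cπ * (1 + ‖π w‖)
  u : MvPolynomial (Fin M) ℂ
  P : Polynomial (MvPolynomial (Fin m) ℂ)
  monic : P.Monic
  c : Fin M → Polynomial (MvPolynomial (Fin m) ℂ)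
  D : MvPolynomial (Fin m) ℂ
  D_ne : D ≠ 0
  onB : ∀ w ∈ B, P.eval₂ (eval (π w)) (eval w u) = 0
  onBc : ∀ w ∈ B, ∀ i, eval (π w) D * w i = (c i).eval₂ (eval (π w)) (eval w u)
  sec : ∀ y t, P.eval₂ (eval y) t = 0 → eval y D ≠ 0 → ∀ w : Fin M → ℂ,
    (∀ i, eval y D * w i = (c i).eval₂ (eval y) t) → w ∈ B ∧ π w = y ∧ eval w u = t
  sep : ∀ y t, P.eval₂ (eval y) t = 0 → eval y D ≠ 0 →
    (Polynomial.derivative P).eval₂ (eval y) t ≠ 0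
  dom : ∀ F : MvPolynomial (Fin m) ℂ, F ≠ 0 → ∃ w ∈ B, eval (π w) F ≠ 0

theorem aux_structure {M : ℕ} (B : Set (Fin M → ℂ)) (hne : B.Nonempty)
    (halg : ∃ S : Set (MvPolynomial (Fin M) ℂ), B = {z | ∀ p ∈ S, eval z p = 0})
    (hprime : ∀ p q : MvPolynomial (Fin M) ℂ, (∀ w ∈ B, eval w p * eval w q = 0) →
      (∀ w ∈ B, eval w p = 0) ∨ (∀ w ∈ B, eval w q = 0)) : Nonempty (AuxCov B) := by
  obtain ⟨m, π, ⟨⟨Cπ, hgr⟩, hint⟩, hdom⟩ := aux_noether_all B hne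
  set R := (auxPhi B LinearMap.id).range with hR
  have hRfun : ∀ r : R, ∃ p : MvPolynomial (Fin M) ℂ, ∀ w : B, r.1 w = eval w.1 p := by
    intro r
    obtain ⟨p, hp⟩ := r.2
    refine ⟨p, fun w => ?_⟩
    rw [← hp]
    exact auxPhi_apply B LinearMap.id p w
  have hmemR : ∀ p : MvPolynomial (Fin M) ℂ, (fun w : B => eval w.1 p) ∈ R := by
    intro p
    refine ⟨p, ?_⟩
    funext w
    exact auxPhi_apply B LinearMap.id p w
  let x : Fin M → R := fun i => ⟨fun w : B => w.1 i, by simpa using hmemR (X i)⟩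
  have hadj : Algebra.adjoin ℂ (Set.range x) = ⊤ := by
    rw [eq_top_iff]
    intro r _
    obtain ⟨p, hp⟩ := hRfun r
    have hr : r = MvPolynomial.aeval x p := by
      apply Subtype.ext
      funext w
      rw [hp]
      clear hp
      induction p using MvPolynomial.induction_on with
      | C a => simp
      | add p q hp hq =>
        rw [map_add, map_add, hp, hq]; rfl
      | mul_X p i hp =>
        rw [map_mul, map_mul, hp, aeval_X, eval_X]; rfl
    rw [hr, Algebra.adjoin_range_eq_range_aeval]
    exact ⟨p, rfl⟩
  have hdomR : IsDomain R := by
    have : Nontrivial R := by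
      refine ⟨0, 1, fun h => ?_⟩
      obtain ⟨w, hw⟩ := hne
      have := congrFun (congrArg Subtype.val h) ⟨w, hw⟩
      simp at this
    have : NoZeroDivisors R := by
      refine ⟨fun {a b} hab => ?_⟩
      obtain ⟨p, hp⟩ := hRfun a
      obtain ⟨q, hq⟩ := hRfun b
      have h1 : ∀ w ∈ B, eval w p * eval w q = 0 := by
        intro w hw
        rw [← hp ⟨w, hw⟩, ← hq ⟨w, hw⟩]
        exact congrFun (congrArg Subtype.val hab) ⟨w, hw⟩
      rcases hprime p q h1 with h | h
      · left
        apply Subtype.ext; funext w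
        rw [hp, h w.1 w.2]; rfl
      · right
        apply Subtype.ext; funext w
        rw [hq, h w.1 w.2]; rfl
    exact NoZeroDivisors.to_isDomain R
  have hphiR : ∀ p, auxPhi B π p ∈ R := by
    intro p
    induction p using MvPolynomial.induction_on with
    | C a =>
      convert hmemR (C a) using 1
      funext w
      rw [auxPhi_apply, eval_C, eval_C]
    | add p q hp hq => rw [map_add]; exact R.add_mem hp hq
    | mul_X p i hp =>
      rw [map_mul]
      refine R.mul_mem hp ?_
      have : auxPhi B π (X i) = ∑ j, (fun w : B => π (Pi.single j 1) i) * (x j).1 := by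
        funext w
        rw [auxPhi_apply, eval_X]
        have e : w.1 = ∑ j, w.1 j • (Pi.single j (1 : ℂ) : Fin M → ℂ) := by
          funext k
          simp [Finset.sum_apply, Pi.single_apply]
        conv_lhs => rw [e]
        rw [map_sum, Finset.sum_apply, Finset.sum_apply]
        refine Finset.sum_congr rfl fun j _ => ?_
        simp [x, mul_comm]
      rw [this]
      refine R.sum_mem fun j _ => R.mul_mem ?_ (x j).2
      convert hmemR (C (π (Pi.single j 1) i)) using 1
      funext w
      rw [eval_C]
  let ψ : MvPolynomial (Fin m) ℂ →ₐ[ℂ] R := (auxPhi B π).codRestrict R hphiR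
  let _ : Algebra (MvPolynomial (Fin m) ℂ) R := ψ.toRingHom.toAlgebra
  have hψ : ∀ (p : MvPolynomial (Fin m) ℂ) (w : B),
      (algebraMap (MvPolynomial (Fin m) ℂ) R p).1 w = eval (π w) p := by
    intro p w
    exact auxPhi_apply B π p w
  have htow : IsScalarTower ℂ (MvPolynomial (Fin m) ℂ) R :=
    IsScalarTower.of_algebraMap_eq fun z => (ψ.commutes z).symm
  have hfaith : FaithfulSMul (MvPolynomial (Fin m) ℂ) R := by
    rw [faithfulSMul_iff_algebraMap_injective, injective_iff_map_eq_zero]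
    intro F hF
    by_contra hF0
    obtain ⟨w, hw, hFw⟩ := hdom F hF0
    apply hFw
    rw [← hψ F ⟨w, hw⟩, hF]; rfl
  have hxint : ∀ j, IsIntegral (MvPolynomial (Fin m) ℂ) (x j) := by
    intro j
    obtain ⟨p, hp, hp0⟩ := hint j
    refine ⟨p, hp, ?_⟩
    apply Subtype.ext
    have := Polynomial.hom_eval₂ p (algebraMap (MvPolynomial (Fin m) ℂ) R)
      (R.val : R →ₐ[ℂ] (B → ℂ)).toRingHom (x j)
    refine Eq.trans this ?_
    exact hp0
  have hintR : Algebra.IsIntegral (MvPolynomial (Fin m) ℂ) R := by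
    refine ⟨fun r => ?_⟩
    have hr : r ∈ Algebra.adjoin ℂ (Set.range x) := by rw [hadj]; trivial
    induction hr using Algebra.adjoin_induction with
    | mem r hr => obtain ⟨i, rfl⟩ := hr; exact hxint i
    | algebraMap z =>
      rw [IsScalarTower.algebraMap_apply ℂ (MvPolynomial (Fin m) ℂ) R]
      exact isIntegral_algebraMap
    | add a b _ _ ha hb => exact ha.add hb
    | mul a b _ _ ha hb => exact ha.mul hb
  obtain ⟨u, P, hmon, hPu, hPdvd, ⟨D2, hD2, A', B', hAB⟩, D1, c, hD1, hc⟩ :=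
    aux_primitive (S := MvPolynomial (Fin m) ℂ) (R := R) x hadj
  obtain ⟨up, hup⟩ := hRfun u
  have hae : ∀ (q : Polynomial (MvPolynomial (Fin m) ℂ)) (w : B),
      (Polynomial.aeval u q : R).1 w = q.eval₂ (eval (π w)) (eval w.1 up) := by
    intro q w
    have := Polynomial.hom_eval₂ q (algebraMap (MvPolynomial (Fin m) ℂ) R)
      ((Pi.evalRingHom (fun _ : B => ℂ) w).comp (R.val : R →ₐ[ℂ] (B → ℂ)).toRingHom) u
    refine Eq.trans this ?_
    have e : ((Pi.evalRingHom (fun _ : B => ℂ) w).comp (R.val : R →ₐ[ℂ] (B → ℂ)).toRingHom).comp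
        (algebraMap (MvPolynomial (Fin m) ℂ) R) = eval (π w) := RingHom.ext fun p => hψ p w
    rw [e]
    congr 1
    exact hup w
  have hdvd : ∀ q : Polynomial (MvPolynomial (Fin m) ℂ),
      (∀ w ∈ B, q.eval₂ (eval (π w)) (eval w up) = 0) → P ∣ q := by
    intro q hq
    apply hPdvd
    apply Subtype.ext
    funext w
    rw [hae, hq w.1 w.2]; rfl
  have hzero : ∀ q : Polynomial (MvPolynomial (Fin m) ℂ),
      (∀ w ∈ B, q.eval₂ (eval (π w)) (eval w up) = 0) → ∀ y t, P.eval₂ (eval y) t = 0 →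
      q.eval₂ (eval y) t = 0 := by
    intro q hq y t hP
    obtain ⟨h, rfl⟩ := hdvd q hq
    rw [Polynomial.eval₂_mul, hP, zero_mul]
  have hB1 : ∀ w ∈ B, ∀ i, eval (π w) D1 * w i = (c i).eval₂ (eval (π w)) (eval w up) := by
    intro w hw i
    rw [← hae (c i) ⟨w, hw⟩, ← hc i]
    change _ = (algebraMap (MvPolynomial (Fin m) ℂ) R D1).1 ⟨w, hw⟩ * (x i).1 ⟨w, hw⟩
    rw [hψ]
  have hkey : ∀ (p : MvPolynomial (Fin M) ℂ) (r : Polynomial (MvPolynomial (Fin m) ℂ)),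
      (∀ w ∈ B, eval w p = r.eval₂ (eval (π w)) (eval w up)) → ∀ y t, P.eval₂ (eval y) t = 0 →
      eval y D1 ≠ 0 → ∀ z : Fin M → ℂ, (∀ i, eval y D1 * z i = (c i).eval₂ (eval y) t) →
      eval z p = r.eval₂ (eval y) t := by
    intro p r hpr y t hP hD z hz
    obtain ⟨e, q, hq⟩ := aux_homog D1 c p
    have h1 := hzero (q - Polynomial.C (D1 ^ e) * r) (by
      intro w hw
      rw [Polynomial.eval₂_sub, hq _ _ w (hB1 w hw), Polynomial.eval₂_mul, Polynomial.eval₂_C,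
        map_pow, hpr w hw, sub_self]) y t hP
    rw [Polynomial.eval₂_sub, hq _ _ z hz, Polynomial.eval₂_mul, Polynomial.eval₂_C, map_pow,
      ← mul_sub] at h1
    rcases mul_eq_zero.1 h1 with h | h
    · exact absurd h (pow_ne_zero _ hD)
    · exact sub_eq_zero.1 h
  refine ⟨⟨m, π, Cπ, hgr, up, P, hmon, fun i => Polynomial.C D2 * c i, D2 * D1,
    mul_ne_zero hD2 hD1, ?_, ?_, ?_, ?_, hdom⟩⟩
  · intro w hw
    rw [← hae P ⟨w, hw⟩, hPu]; rfl
  · intro w hw i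
    rw [Polynomial.eval₂_mul, Polynomial.eval₂_C, ← hB1 w hw i, map_mul, mul_assoc]
  · intro y t hP hD z hz
    rw [map_mul] at hD
    have hD1' := right_ne_zero_of_mul hD
    have hD2' := left_ne_zero_of_mul hD
    have hz' : ∀ i, eval y D1 * z i = (c i).eval₂ (eval y) t := by
      intro i
      have := hz i
      rw [Polynomial.eval₂_mul, Polynomial.eval₂_C, map_mul, mul_assoc] at this
      exact mul_left_cancel₀ hD2' this
    refine ⟨?_, ?_, ?_⟩
    · obtain ⟨S, hS⟩ := halg
      rw [hS]
      intro p hp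
      have := hkey p 0 (by
        intro w hw
        rw [hS] at hw
        rw [hw p hp, Polynomial.eval₂_zero]) y t hP hD1' z hz'
      rw [this, Polynomial.eval₂_zero]
    · funext i
      have hlin : ∀ w : Fin M → ℂ, eval w (∑ j, C (π (Pi.single j 1) i) * X j) = π w i := by
        intro w
        have e : w = ∑ j, w j • (Pi.single j (1 : ℂ) : Fin M → ℂ) := by
          funext k
          simp [Finset.sum_apply, Pi.single_apply]
        conv_rhs => rw [e]
        rw [map_sum, map_sum, Finset.sum_apply]
        refine Finset.sum_congr rfl fun j _ => ?_
        simp [mul_comm]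
      have := hkey (∑ j, C (π (Pi.single j 1) i) * X j) (Polynomial.C (X i)) (by
        intro w hw
        rw [hlin, Polynomial.eval₂_C, eval_X]) y t hP hD1' z hz'
      rw [hlin, Polynomial.eval₂_C, eval_X] at this
      exact this
    · have := hkey up Polynomial.X (by
        intro w hw
        rw [Polynomial.eval₂_X]) y t hP hD1' z hz'
      rw [Polynomial.eval₂_X] at this
      exact this
  · intro y t hP hD h0
    rw [map_mul] at hD
    have h1 := congrArg (Polynomial.eval₂ (eval y) t) hAB
    rw [Polynomial.eval₂_add, Polynomial.eval₂_mul, Polynomial.eval₂_mul, hP, h0,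
      Polynomial.eval₂_C] at h1
    apply left_ne_zero_of_mul hD
    rw [← h1]; ring


theorem aux_eval_analytic {E : Type*} [NormedAddCommGroup E] [NormedSpace ℂ E] {ι : Type*} [Fintype ι]
    (p : MvPolynomial ι ℂ) (f : E → (ι → ℂ)) (x : E)
    (hf : AnalyticAt ℂ f x) : AnalyticAt ℂ (fun x => eval (f x) p) x := by
  have := AnalyticAt.aeval_mvPolynomial (f := f) (z := x)
    (fun i => (analyticAt_pi_iff.1 hf) i) p
  exact this

theorem aux_eval2_analytic {E : Type*} [NormedAddCommGroup E] [NormedSpace ℂ E] {m : ℕ}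
    (p : Polynomial (MvPolynomial (Fin m) ℂ)) (f : E → (Fin m → ℂ)) (g : E → ℂ) (x : E)
    (hf : AnalyticAt ℂ f x) (hg : AnalyticAt ℂ g x) :
    AnalyticAt ℂ (fun x => p.eval₂ (eval (f x)) (g x)) x := by
  simp only [Polynomial.eval₂_eq_sum, Polynomial.sum]
  apply Finset.analyticAt_fun_sum
  intro n _
  apply AnalyticAt.mul _ (hg.pow n)
  exact aux_eval_analytic _ _ _ hf

/-- sheets via the implicit function theorem -/
theorem aux_sheet {m : ℕ} (P : Polynomial (MvPolynomial (Fin m) ℂ)) (y0 : Fin m → ℂ) (t0 : ℂ)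
    (h0 : P.eval₂ (eval y0) t0 = 0) (h1 : (Polynomial.derivative P).eval₂ (eval y0) t0 ≠ 0) :
    ∃ τ : (Fin m → ℂ) → ℂ, AnalyticAt ℂ τ y0 ∧ τ y0 = t0 ∧
      ∀ᶠ p in 𝓝 (y0, t0), P.eval₂ (eval p.1) p.2 = 0 ↔ τ p.1 = p.2 := by
  set F : (Fin m → ℂ) × ℂ → ℂ := fun p => P.eval₂ (eval p.1) p.2 with hF
  have han : AnalyticAt ℂ F (y0, t0) := aux_eval2_analytic P _ _ _ analyticAt_fst analyticAt_snd
  have hcd : ContDiffAt ℂ ⊤ F (y0, t0) := han.contDiffAt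
  have hder : ((fderiv ℂ F (y0, t0)) ∘L (.inr ℂ (Fin m → ℂ) ℂ)) 1
      = (Polynomial.derivative P).eval₂ (eval y0) t0 := by
    have hd := han.differentiableAt.hasFDerivAt
    have h2 : HasDerivAt (fun t => F (y0, t)) ((fderiv ℂ F (y0, t0)) (0, 1)) t0 := by
      have := HasFDerivAt.comp_hasDerivAt (x := t0) (f := fun t : ℂ => (y0, t)) (f' := ((0 : Fin m → ℂ), (1 : ℂ))) (l := F)
        (l' := fderiv ℂ F (y0, t0)) hd ((hasDerivAt_const t0 y0).prodMk (hasDerivAt_id t0))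
      exact this
    have h3 : HasDerivAt (fun t => F (y0, t)) ((Polynomial.derivative P).eval₂ (eval y0) t0) t0 := by
      have := (P.map (eval y0)).hasDerivAt t0
      simpa [hF, Polynomial.eval_map, Polynomial.derivative_map] using this
    simpa using h2.unique h3
  have hinv : ((fderiv ℂ F (y0, t0)) ∘L (.inr ℂ (Fin m → ℂ) ℂ)).IsInvertible := by
    set L := ((fderiv ℂ F (y0, t0)) ∘L (.inr ℂ (Fin m → ℂ) ℂ)) with hL
    have hne : L 1 ≠ 0 := by rw [hder]; exact h1
    have : ∀ x, L x = L 1 * x := fun x => by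
      have := L.map_smul x 1
      simp only [smul_eq_mul, mul_one] at this
      rw [this, mul_comm]
    refine ⟨ContinuousLinearEquiv.unitsEquivAut ℂ (Units.mk0 _ hne), ?_⟩
    ext
    simp
  refine ⟨hcd.implicitFunction (by simp) hinv, ?_, ?_, ?_⟩
  · exact (hcd.contDiffAt_implicitFunction (by simp) hinv).analyticAt
  · exact hcd.implicitFunction_apply_self (by simp) hinv
  · have := hcd.eventually_apply_eq_iff_implicitFunction (by simp) hinv
    have e : F (y0, t0) = 0 := h0
    rw [e] at this
    exact this

namespace AuxCov

variable {M : ℕ} {B : Set (Fin M → ℂ)} (X : AuxCov B)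

/-- the roots over `y`. -/
noncomputable def rts (y : Fin X.m → ℂ) : Finset ℂ := (X.P.map (eval y)).roots.toFinset

/-- the section. -/
noncomputable def sg (y : Fin X.m → ℂ) (t : ℂ) : Fin M → ℂ :=
  fun i => (X.c i).eval₂ (eval y) t / eval y X.D

theorem mem_rts (y : Fin X.m → ℂ) (t : ℂ) : t ∈ X.rts y ↔ X.P.eval₂ (eval y) t = 0 := by
  have : X.P.map (eval y) ≠ 0 := (X.monic.map _).ne_zero
  rw [rts, Multiset.mem_toFinset, Polynomial.mem_roots this, Polynomial.IsRoot,
    Polynomial.eval_map]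

theorem sg_spec {y : Fin X.m → ℂ} {t : ℂ} (hy : eval y X.D ≠ 0) (ht : t ∈ X.rts y) :
    X.sg y t ∈ B ∧ X.π (X.sg y t) = y ∧ eval (X.sg y t) X.u = t := by
  apply X.sec y t ((X.mem_rts y t).1 ht) hy
  intro i
  simp only [sg]
  field_simp

theorem u_mem {w : Fin M → ℂ} (hw : w ∈ B) : eval w X.u ∈ X.rts (X.π w) :=
  (X.mem_rts _ _).2 (X.onB w hw)

theorem sg_u {w : Fin M → ℂ} (hw : w ∈ B) (hy : eval (X.π w) X.D ≠ 0) :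
    X.sg (X.π w) (eval w X.u) = w := by
  funext i
  simp only [sg]
  rw [← X.onBc w hw i]
  field_simp

theorem card_rts {y : Fin X.m → ℂ} (hy : eval y X.D ≠ 0) : (X.rts y).card = X.P.natDegree := by
  have hne : X.P.map (eval y) ≠ 0 := (X.monic.map _).ne_zero
  have hnd : (X.P.map (eval y)).roots.Nodup := by
    rw [Multiset.nodup_iff_count_le_one]
    intro t
    rw [Polynomial.count_roots]
    by_contra hc
    push Not at hc
    have h2 := (Polynomial.one_lt_rootMultiplicity_iff_isRoot hne).1 hc
    have h3 := h2.2
    rw [Polynomial.derivative_map, Polynomial.IsRoot, Polynomial.eval_map] at h3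
    have h4 := h2.1
    rw [Polynomial.IsRoot, Polynomial.eval_map] at h4
    exact X.sep y t h4 hy h3
  rw [rts, Multiset.toFinset_card_of_nodup hnd, IsAlgClosed.card_roots_eq_natDegree, X.monic.natDegree_map]

theorem D_nhds {y0 : Fin X.m → ℂ} (hy : eval y0 X.D ≠ 0) : ∀ᶠ y in 𝓝 y0, eval y X.D ≠ 0 :=
  (MvPolynomial.continuous_eval X.D).continuousAt.eventually_ne hy

theorem sheets {y0 : Fin X.m → ℂ} (hy : eval y0 X.D ≠ 0) : ∃ τ : ℂ → (Fin X.m → ℂ) → ℂ,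
    (∀ t ∈ X.rts y0, AnalyticAt ℂ (τ t) y0 ∧ τ t y0 = t ∧
      ∀ᶠ p in 𝓝 (y0, t), X.P.eval₂ (eval p.1) p.2 = 0 ↔ τ t p.1 = p.2) ∧
    ∀ᶠ y in 𝓝 y0, eval y X.D ≠ 0 ∧ X.rts y = (X.rts y0).image (fun t => τ t y) ∧
      Set.InjOn (fun t => τ t y) (X.rts y0) := by
  have h := fun t : ℂ => fun ht : t ∈ X.rts y0 => aux_sheet X.P y0 t ((X.mem_rts _ _).1 ht)
    (X.sep y0 t ((X.mem_rts _ _).1 ht) hy)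
  choose! τ hτ using h
  refine ⟨τ, hτ, ?_⟩
  have hinj : ∀ᶠ y in 𝓝 y0, Set.InjOn (fun t => τ t y) (X.rts y0) := by
    have : ∀ᶠ y in 𝓝 y0, ∀ t ∈ X.rts y0, ∀ t' ∈ X.rts y0, t ≠ t' → τ t y ≠ τ t' y := by
      rw [Finset.eventually_all]
      intro t ht
      rw [Finset.eventually_all]
      intro t' ht'
      by_cases h : t = t'
      · simp [h]
      · have h1 := (hτ t ht).1.continuousAt
        have h2 := (hτ t' ht').1.continuousAt
        have := (h1.ne_iff_eventually_ne h2).1 (by rw [(hτ t ht).2.1, (hτ t' ht').2.1]; exact h)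
        filter_upwards [this] with y hy _ using hy
    filter_upwards [this] with y hy' t ht t' ht' e
    by_contra hne
    exact hy' t ht t' ht' hne e
  have hroot : ∀ᶠ y in 𝓝 y0, ∀ t ∈ X.rts y0, τ t y ∈ X.rts y := by
    rw [Finset.eventually_all]
    intro t ht
    obtain ⟨h1, h2, h3⟩ := hτ t ht
    have hc : Tendsto (fun y => (y, τ t y)) (𝓝 y0) (𝓝 (y0, t)) := by
      have := h1.continuousAt.tendsto
      rw [h2] at this
      exact tendsto_id.prodMk_nhds this
    filter_upwards [hc.eventually h3] with y h
    rw [X.mem_rts]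
    exact h.2 rfl
  filter_upwards [X.D_nhds hy, hinj, hroot] with y h1 h2 h3
  refine ⟨h1, ?_, h2⟩
  symm
  apply Finset.eq_of_subset_of_card_le
  · intro s hs
    obtain ⟨t, ht, rfl⟩ := Finset.mem_image.1 hs
    exact h3 t ht
  · rw [Finset.card_image_of_injOn h2, X.card_rts h1, X.card_rts hy]

/-- local constancy of a predicate along sheets -/
def LC (G : (Fin X.m → ℂ) → ℂ → Prop) : Prop :=
  ∀ y0, eval y0 X.D ≠ 0 → ∀ t ∈ X.rts y0, ∀ᶠ p in 𝓝 (y0, t),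
    X.P.eval₂ (eval p.1) p.2 = 0 → (G p.1 p.2 ↔ G y0 t)

open Classical in
theorem sheets_filter (G : (Fin X.m → ℂ) → ℂ → Prop) (hG : X.LC G)
    {y0 : Fin X.m → ℂ} (hy : eval y0 X.D ≠ 0) : ∃ τ : ℂ → (Fin X.m → ℂ) → ℂ,
    (∀ t ∈ X.rts y0, AnalyticAt ℂ (τ t) y0 ∧ τ t y0 = t) ∧
    ∀ᶠ y in 𝓝 y0, eval y X.D ≠ 0 ∧
      (X.rts y).filter (G y) = ((X.rts y0).filter (G y0)).image (fun t => τ t y) ∧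
      Set.InjOn (fun t => τ t y) (X.rts y0) := by
  obtain ⟨τ, h1, h2⟩ := X.sheets hy
  refine ⟨τ, fun t ht => ⟨(h1 t ht).1, (h1 t ht).2.1⟩, ?_⟩
  have h3 : ∀ᶠ y in 𝓝 y0, ∀ t ∈ X.rts y0, X.P.eval₂ (eval y) (τ t y) = 0 → (G y (τ t y) ↔ G y0 t) := by
    rw [Finset.eventually_all]
    intro t ht
    have hc : Tendsto (fun y => (y, τ t y)) (𝓝 y0) (𝓝 (y0, t)) := by
      have := (h1 t ht).1.continuousAt.tendsto
      rw [(h1 t ht).2.1] at this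
      exact tendsto_id.prodMk_nhds this
    exact hc.eventually (hG y0 hy t ht)
  filter_upwards [h2, h3] with y ⟨ha, hb, hc⟩ hd
  refine ⟨ha, ?_, hc⟩
  ext s
  simp only [Finset.mem_filter, Finset.mem_image]
  constructor
  · rintro ⟨hs, hGs⟩
    rw [hb] at hs
    obtain ⟨t, ht, rfl⟩ := Finset.mem_image.1 hs
    have : τ t y ∈ X.rts y := by rw [hb]; exact hs
    exact ⟨t, ⟨ht, (hd t ht ((X.mem_rts _ _).1 this)).1 hGs⟩, rfl⟩
  · rintro ⟨t, ⟨ht, hGt⟩, rfl⟩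
    have : τ t y ∈ X.rts y := by rw [hb]; exact Finset.mem_image_of_mem _ ht
    exact ⟨this, (hd t ht ((X.mem_rts _ _).1 this)).2 hGt⟩

open Classical in
theorem prod_analytic (G : (Fin X.m → ℂ) → ℂ → Prop) (hG : X.LC G)
    {E : Type*} [NormedAddCommGroup E] [NormedSpace ℂ E] (pr : E → (Fin X.m → ℂ)) (Φ : E × ℂ → ℂ) (x0 : E)
    (hpr : AnalyticAt ℂ pr x0) (hy : eval (pr x0) X.D ≠ 0)
    (hΦ : ∀ t ∈ X.rts (pr x0), AnalyticAt ℂ Φ (x0, t)) :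
    AnalyticAt ℂ (fun x => ∏ t ∈ (X.rts (pr x)).filter (G (pr x)), Φ (x, t)) x0 ∧
    AnalyticAt ℂ (fun x => ∑ t ∈ (X.rts (pr x)).filter (G (pr x)), Φ (x, t)) x0 := by
  obtain ⟨τ, h1, h2⟩ := X.sheets_filter G hG hy
  have h3 := hpr.continuousAt.eventually h2
  have hterm : ∀ t ∈ (X.rts (pr x0)).filter (G (pr x0)), AnalyticAt ℂ (fun x => Φ (x, τ t (pr x))) x0 := by
    intro t ht
    have ht' := (Finset.mem_filter.1 ht).1
    obtain ⟨ha, hb⟩ := h1 t ht'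
    have hc : AnalyticAt ℂ (fun x => (x, τ t (pr x))) x0 :=
      AnalyticAt.prod analyticAt_id (AnalyticAt.fun_comp ha hpr)
    apply AnalyticAt.fun_comp (g := Φ) (f := fun x => (x, τ t (pr x)))
    · simp only [hb]
      exact hΦ t ht'
    · exact hc
  constructor
  · have := Finset.analyticAt_fun_prod _ hterm
    refine this.congr ?_
    filter_upwards [h3] with x ⟨_, hx, hi⟩
    rw [hx, Finset.prod_image]
    exact fun a ha b hb' e => hi (Finset.mem_filter.1 ha).1 (Finset.mem_filter.1 hb').1 e
  · have := Finset.analyticAt_fun_sum _ hterm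
    refine this.congr ?_
    filter_upwards [h3] with x ⟨_, hx, hi⟩
    rw [hx, Finset.sum_image]
    exact fun a ha b hb' e => hi (Finset.mem_filter.1 ha).1 (Finset.mem_filter.1 hb').1 e

theorem sg_analytic {y : Fin X.m → ℂ} (hy : eval y X.D ≠ 0) (t : ℂ) :
    AnalyticAt ℂ (fun p : (Fin X.m → ℂ) × ℂ => X.sg p.1 p.2) (y, t) := by
  rw [analyticAt_pi_iff]
  intro i
  simp only [sg]
  refine AnalyticAt.div (aux_eval2_analytic (X.c i) _ _ _ analyticAt_fst analyticAt_snd) ?_ hy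
  exact aux_eval_analytic _ _ _ analyticAt_fst

theorem q_sg_analytic (q : MvPolynomial (Fin M) ℂ) {y : Fin X.m → ℂ} (hy : eval y X.D ≠ 0) (t : ℂ) :
    AnalyticAt ℂ (fun p : (Fin X.m → ℂ) × ℂ => eval (X.sg p.1 p.2) q) (y, t) := by
  exact aux_eval_analytic _ _ _ (X.sg_analytic hy t)

end AuxCov


theorem aux_poly_growth {ι : Type*} [Fintype ι] (q : MvPolynomial ι ℂ) (k : ℕ) (hk : q.totalDegree ≤ k) :
    ∃ A : ℝ, 0 ≤ A ∧ ∀ w : ι → ℂ, ‖eval w q‖ ≤ A * (1 + ‖w‖) ^ k := by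
  refine ⟨∑ d ∈ q.support, ‖q.coeff d‖, Finset.sum_nonneg fun _ _ => norm_nonneg _, fun w => ?_⟩
  rw [MvPolynomial.eval_eq, Finset.sum_mul]
  refine (norm_sum_le _ _).trans (Finset.sum_le_sum fun d hd => ?_)
  rw [norm_mul]
  refine mul_le_mul_of_nonneg_left ?_ (norm_nonneg _)
  have h1 : (1:ℝ) ≤ 1 + ‖w‖ := by linarith [norm_nonneg w]
  rw [norm_prod]
  calc ∏ i ∈ d.support, ‖w i ^ d i‖ ≤ ∏ i ∈ d.support, (1 + ‖w‖) ^ d i := by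
        refine Finset.prod_le_prod (fun _ _ => norm_nonneg _) fun i _ => ?_
        rw [norm_pow]
        refine pow_le_pow_left₀ (norm_nonneg _) ?_ _
        linarith [norm_le_pi_norm w i]
    _ = (1 + ‖w‖) ^ (∑ i ∈ d.support, d i) := Finset.prod_pow_eq_pow_sum _ _ _
    _ ≤ (1 + ‖w‖) ^ k := pow_le_pow_right₀ h1 ((le_totalDegree hd).trans hk)

namespace AuxCov

variable {M : ℕ} {B : Set (Fin M → ℂ)} (X : AuxCov B)

theorem growth_q (q : MvPolynomial (Fin M) ℂ) (k : ℕ) (hk : q.totalDegree ≤ k) :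
    ∃ A : ℝ, 0 ≤ A ∧ ∀ w ∈ B, ‖eval w q‖ ≤ A * (1 + ‖X.π w‖) ^ k := by
  obtain ⟨A, hA, h⟩ := aux_poly_growth q k hk
  refine ⟨A * (1 + |X.Cπ|) ^ k, by positivity, fun w hw => (h w).trans ?_⟩
  rw [mul_assoc, ← mul_pow]
  gcongr
  have := X.growth w hw
  have h2 := norm_nonneg (X.π w)
  nlinarith [le_abs_self X.Cπ, abs_nonneg X.Cπ]

theorem LC_true : X.LC (fun _ _ => True) := fun _ _ _ _ => by simp

theorem LC_not {G : (Fin X.m → ℂ) → ℂ → Prop} (hG : X.LC G) : X.LC (fun y t => ¬ G y t) := by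
  intro y0 hy t ht
  filter_upwards [hG y0 hy t ht] with p hp h
  rw [hp h]

open Classical in
theorem theta (G : (Fin X.m → ℂ) → ℂ → Prop) (hG : X.LC G) (q : MvPolynomial (Fin M) ℂ) :
    ∃ p : MvPolynomial (Option (Fin X.m)) ℂ, ∀ x : Option (Fin X.m) → ℂ,
      eval (fun i => x (some i)) X.D ≠ 0 →
      eval x p = ∏ t ∈ (X.rts (fun i => x (some i))).filter (G (fun i => x (some i))),
        (x none - eval (X.sg (fun i => x (some i)) t) q) := by
  obtain ⟨A, hA, hgr⟩ := X.growth_q q q.totalDegree le_rfl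
  set k := q.totalDegree
  have hD : rename (some : Fin X.m → Option (Fin X.m)) X.D ≠ 0 := by
    intro h
    apply X.D_ne
    apply rename_injective _ (Option.some_injective _)
    simpa using h
  have hDe : ∀ x : Option (Fin X.m) → ℂ, eval x (rename (some : Fin X.m → Option (Fin X.m)) X.D)
      = eval (fun i => x (some i)) X.D := fun x => by rw [eval_rename]; rfl
  suffices key : ∃ p, ∀ x : Option (Fin X.m) → ℂ,
      eval x (rename (some : Fin X.m → Option (Fin X.m)) X.D) ≠ 0 →
      (fun x : Option (Fin X.m) → ℂ => ∏ t ∈ (X.rts (fun i => x (some i))).filter (G (fun i => x (some i))),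
        (x none - eval (X.sg (fun i => x (some i)) t) q)) x = eval x p by
    obtain ⟨p, hp⟩ := key
    refine ⟨p, fun x hx => (hp x ?_).symm⟩
    rw [hDe]; exact hx
  refine aux_multipoly _ _ hD (K := (A + 1) ^ X.P.natDegree)
        (n := (k + 1) * X.P.natDegree) ?_ ?_
  · intro x hx
    rw [hDe] at hx
    have hpr : ∀ x0 : Option (Fin X.m) → ℂ, AnalyticAt ℂ (fun (x : Option (Fin X.m) → ℂ) (i : Fin X.m) => x (some i)) x0 := by
      intro x0
      rw [analyticAt_pi_iff]
      intro i
      exact (ContinuousLinearMap.proj (R := ℂ) (φ := fun _ : Option (Fin X.m) => ℂ) (some i)).analyticAt x0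
    refine (X.prod_analytic G hG (fun (x : Option (Fin X.m) → ℂ) (i : Fin X.m) => x (some i))
      (fun z => z.1 none - eval (X.sg (fun i => z.1 (some i)) z.2) q) x (hpr x) hx ?_).1
    intro t ht
    refine AnalyticAt.sub ?_ ?_
    · exact AnalyticAt.fun_comp (g := fun x : Option (Fin X.m) → ℂ => x none) (f := Prod.fst)
        ((ContinuousLinearMap.proj (R := ℂ) (φ := fun _ : Option (Fin X.m) => ℂ) none).analyticAt _)
        analyticAt_fst
    · refine AnalyticAt.fun_comp (g := fun p : (Fin X.m → ℂ) × ℂ => eval (X.sg p.1 p.2) q)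
        (f := fun z : (Option (Fin X.m) → ℂ) × ℂ => ((fun i => z.1 (some i) : Fin X.m → ℂ), z.2))
        (X.q_sg_analytic q hx t) ?_
      exact AnalyticAt.prod (AnalyticAt.fun_comp (f := Prod.fst) (hpr _) analyticAt_fst) analyticAt_snd
  · intro x hx
    rw [hDe] at hx
    set y : Fin X.m → ℂ := fun i => x (some i) with hy
    have hyx : ‖y‖ ≤ ‖x‖ := by
      rw [pi_norm_le_iff_of_nonneg (norm_nonneg _)]
      exact fun i => norm_le_pi_norm x _
    have h1 : (1:ℝ) ≤ 1 + ‖x‖ := by linarith [norm_nonneg x]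
    rw [norm_prod]
    have hf : ∀ t ∈ (X.rts y).filter (G y), ‖x none - eval (X.sg y t) q‖ ≤ (A + 1) * (1 + ‖x‖) ^ (k + 1) := by
      intro t ht
      obtain ⟨hs1, hs2, hs3⟩ := X.sg_spec hx (Finset.mem_filter.1 ht).1
      have h2 := hgr _ hs1
      rw [hs2] at h2
      calc ‖x none - eval (X.sg y t) q‖ ≤ ‖x none‖ + ‖eval (X.sg y t) q‖ := norm_sub_le _ _
        _ ≤ (1 + ‖x‖) ^ (k + 1) + A * (1 + ‖x‖) ^ (k + 1) := by
            refine add_le_add ?_ (h2.trans ?_)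
            · calc ‖x none‖ ≤ (1 + ‖x‖) ^ 1 := by rw [pow_one]; linarith [norm_le_pi_norm x none]
                _ ≤ _ := pow_le_pow_right₀ h1 (by omega)
            · calc A * (1 + ‖y‖) ^ k ≤ A * (1 + ‖x‖) ^ k := by gcongr
                _ ≤ A * (1 + ‖x‖) ^ (k + 1) := 
                    mul_le_mul_of_nonneg_left (pow_le_pow_right₀ h1 (by omega)) hA
        _ = _ := by ring
    have hone : 1 ≤ (A + 1) * (1 + ‖x‖) ^ (k + 1) := one_le_mul_of_one_le_of_one_le (by linarith) (one_le_pow₀ h1)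
    calc ∏ t ∈ (X.rts y).filter (G y), ‖x none - eval (X.sg y t) q‖
        ≤ ∏ t ∈ (X.rts y).filter (G y), (A + 1) * (1 + ‖x‖) ^ (k + 1) :=
          Finset.prod_le_prod (fun _ _ => norm_nonneg _) hf
      _ = ((A + 1) * (1 + ‖x‖) ^ (k + 1)) ^ ((X.rts y).filter (G y)).card := by rw [Finset.prod_const]
      _ ≤ ((A + 1) * (1 + ‖x‖) ^ (k + 1)) ^ X.P.natDegree := by
          refine pow_le_pow_right₀ hone ?_
          rw [← X.card_rts hx]
          exact Finset.card_filter_le _ _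
      _ = _ := by rw [mul_pow, ← pow_mul]

end AuxCov


namespace AuxCov

variable {M : ℕ} {B : Set (Fin M → ℂ)} (X : AuxCov B)

theorem pull (p : MvPolynomial (Option (Fin X.m)) ℂ) (q : MvPolynomial (Fin M) ℂ) :
    ∃ r : MvPolynomial (Fin M) ℂ, ∀ w,
      eval w r = eval (fun o : Option (Fin X.m) => o.elim (eval w q) (X.π w)) p := by
  refine ⟨bind₁ (fun o : Option (Fin X.m) => o.elim q
    (fun i => ∑ j, MvPolynomial.C (X.π (Pi.single j 1) i) * MvPolynomial.X j)) p, fun w => ?_⟩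
  have : (fun o : Option (Fin X.m) => o.elim (eval w q) (X.π w)) =
      fun o : Option (Fin X.m) => eval w (o.elim q
    (fun i => ∑ j, MvPolynomial.C (X.π (Pi.single j 1) i) * MvPolynomial.X j)) := by
    funext o
    cases o with
    | none => rfl
    | some i =>
      simp only [Option.elim, map_sum, map_mul, eval_C, eval_X]
      conv_lhs => rw [pi_eq_sum_univ' w]
      simp only [map_sum, map_smul, Finset.sum_apply, Pi.smul_apply, smul_eq_mul]
      refine Finset.sum_congr rfl fun j _ => ?_
      rw [mul_comm]
  rw [this]
  have h2 := eval₂Hom_bind₁ (RingHom.id ℂ) w (fun o : Option (Fin X.m) => o.elim q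
    (fun i => ∑ j, MvPolynomial.C (X.π (Pi.single j 1) i) * MvPolynomial.X j)) p
  exact h2

theorem zero_of_generic
    (hprime : ∀ p q : MvPolynomial (Fin M) ℂ, (∀ w ∈ B, eval w p * eval w q = 0) →
      (∀ w ∈ B, eval w p = 0) ∨ (∀ w ∈ B, eval w q = 0))
    (r : MvPolynomial (Fin M) ℂ) (h : ∀ w ∈ B, eval (X.π w) X.D ≠ 0 → eval w r = 0) :
    ∀ w ∈ B, eval w r = 0 := by
  obtain ⟨D', hD'⟩ := X.pull (rename some X.D) 0
  have hD2 : ∀ w, eval w D' = eval (X.π w) X.D := fun w => by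
    rw [hD', eval_rename]; rfl
  have hDr : ∀ w ∈ B, eval w D' * eval w r = 0 := by
    intro w hw
    rw [hD2]
    by_cases h0 : eval (X.π w) X.D = 0
    · simp [h0]
    · simp [h w hw h0]
  rcases hprime D' r hDr with h1 | h1
  · obtain ⟨w, hw, hne⟩ := X.dom X.D X.D_ne
    exact absurd (h1 w hw) (by rw [hD2]; exact hne)
  · exact h1

theorem D_dense (y : Fin X.m → ℂ) : y ∈ closure {y' | eval y' X.D ≠ 0} := by
  obtain ⟨y1, hy1⟩ := aux_exists_ne X.D_ne
  obtain ⟨F, hF⟩ := aux_line_zeros X.D y (y1 - y) (l₀ := 1) (by simpa using hy1)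
  have h0 : (0 : ℂ) ∈ closure ((F : Set ℂ)ᶜ) := (F.countable_toSet.dense_compl ℂ) 0
  have := map_mem_closure (f := fun l : ℂ => y + l • (y1 - y)) (t := {y' | eval y' X.D ≠ 0})
    (by fun_prop) h0 (fun l hl => by
      change eval _ X.D ≠ 0
      intro h
      exact hl ((hF l).1 h))
  simpa using this

open Classical in
theorem dense
    (hprime : ∀ p q : MvPolynomial (Fin M) ℂ, (∀ w ∈ B, eval w p * eval w q = 0) →
      (∀ w ∈ B, eval w p = 0) ∨ (∀ w ∈ B, eval w q = 0))
    (w0 : Fin M → ℂ) (hw0 : w0 ∈ B) : w0 ∈ closure {w | w ∈ B ∧ eval (X.π w) X.D ≠ 0} := by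
  rw [Metric.mem_closure_iff]
  by_contra hcon
  push Not at hcon
  obtain ⟨ε, hε, hcon⟩ := hcon
  obtain ⟨y, hyD, hylim⟩ := mem_closure_iff_seq_limit.1 (X.D_dense (X.π w0))
  set s := X.P.natDegree with hs
  let e : ∀ n, X.rts (y n) ≃ Fin s := fun n => Finset.equivFinOfCardEq (X.card_rts (hyD n))
  let W : ℕ → Fin s → Fin M → ℂ := fun n l => X.sg (y n) ((e n).symm l)
  have hW : ∀ n l, W n l ∈ B ∧ X.π (W n l) = y n := fun n l => by
    have := X.sg_spec (hyD n) ((e n).symm l).2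
    exact ⟨this.1, this.2.1⟩
  have hWε : ∀ n l, ε ≤ dist w0 (W n l) := fun n l => hcon _ ⟨(hW n l).1, by
    rw [(hW n l).2]; exact hyD n⟩
  obtain ⟨R, hR⟩ : ∃ R, ∀ n, ‖y n‖ ≤ R := by
    obtain ⟨R, hR⟩ := (Metric.isBounded_range_of_tendsto y hylim).exists_norm_le
    exact ⟨R, fun n => hR _ ⟨n, rfl⟩⟩
  have hR0 : 0 ≤ R := (norm_nonneg _).trans (hR 0)
  have hWb : ∀ n, W n ∈ Metric.closedBall (0 : Fin s → Fin M → ℂ) (|X.Cπ| * (1 + R)) := by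
    intro n
    rw [mem_closedBall_zero_iff, pi_norm_le_iff_of_nonneg (by positivity)]
    intro l
    have := X.growth _ (hW n l).1
    rw [(hW n l).2] at this
    refine this.trans ?_
    exact mul_le_mul (le_abs_self _) (by linarith [hR n]) (by positivity) (abs_nonneg _)
  obtain ⟨Ws, -, φ, hφ, hlim⟩ := tendsto_subseq_of_bounded Metric.isBounded_closedBall hWb
  have hWs : ∀ l, Ws l - w0 ≠ 0 := by
    intro l h
    have h1 : Tendsto (fun n => dist w0 (W (φ n) l)) atTop (𝓝 (dist w0 (Ws l))) :=
      tendsto_const_nhds.dist ((tendsto_pi_nhds.1 hlim) l)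
    have h2 := ge_of_tendsto' h1 (fun n => hWε _ l)
    rw [sub_eq_zero.1 h, dist_self] at h2
    linarith
  obtain ⟨a, ha⟩ : ∃ a : Fin M → ℂ, ∀ l, ∑ i, (Ws l - w0) i * a i ≠ 0 := by
    have hne : (∏ l, ∑ i, MvPolynomial.C ((Ws l - w0) i) * MvPolynomial.X i : MvPolynomial (Fin M) ℂ) ≠ 0 := by
      rw [Finset.prod_ne_zero_iff]
      intro l _ h
      apply hWs l
      funext i
      have := congrArg (eval (Pi.single i (1:ℂ))) h
      simpa [Pi.single_apply] using this
    obtain ⟨a, ha⟩ := aux_exists_ne hne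
    refine ⟨a, fun l => ?_⟩
    simp only [map_prod, map_sum, map_mul, eval_C, eval_X, Finset.prod_ne_zero_iff] at ha
    exact ha l (Finset.mem_univ _)
  set g : MvPolynomial (Fin M) ℂ := ∑ i, MvPolynomial.C (a i) * MvPolynomial.X i with hg
  have hge : ∀ w, eval w g = ∑ i, a i * w i := fun w => by simp [hg]
  obtain ⟨p, hp⟩ := X.theta _ X.LC_true g
  simp only [Finset.filter_true] at hp
  obtain ⟨r, hr⟩ := X.pull p g
  have hz := X.zero_of_generic hprime r (fun w hw hD => by
    rw [hr, hp _ (by simpa using hD)]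
    refine Finset.prod_eq_zero (X.u_mem hw) ?_
    have := X.sg_u hw hD
    simp only [Option.elim]
    rw [this, sub_self]) w0 hw0
  rw [hr] at hz
  have h1 : Tendsto (fun n => eval (fun o : Option (Fin X.m) => o.elim (eval w0 g) (y (φ n))) p) atTop (𝓝 0) := by
    rw [← hz]
    refine ((MvPolynomial.continuous_eval p).tendsto _).comp ?_
    rw [tendsto_pi_nhds]
    intro o
    cases o with
    | none => exact tendsto_const_nhds
    | some i => exact (tendsto_pi_nhds.1 (hylim.comp hφ.tendsto_atTop)) i
  have h2 : ∀ n, eval (fun o : Option (Fin X.m) => o.elim (eval w0 g) (y n)) p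
      = ∏ l, (eval w0 g - eval (W n l) g) := by
    intro n
    have hyn : eval (y n) X.D ≠ 0 := hyD n
    rw [hp (fun o : Option (Fin X.m) => o.elim (eval w0 g) (y n)) (by simpa using hyn)]
    simp only [Option.elim]
    rw [← Finset.prod_coe_sort]
    exact Fintype.prod_equiv (e n) _ _ (fun t => by simp only [W, Equiv.symm_apply_apply])
  simp only [h2] at h1
  have h3 : Tendsto (fun n => ∏ l, (eval w0 g - eval (W (φ n) l) g)) atTop
      (𝓝 (∏ l, (eval w0 g - eval (Ws l) g))) := by
    refine tendsto_finsetProd _ fun l _ => ?_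
    exact tendsto_const_nhds.sub (((MvPolynomial.continuous_eval g).tendsto _).comp ((tendsto_pi_nhds.1 hlim) l))
  have h4 := tendsto_nhds_unique h1 h3
  obtain ⟨l, -, hl⟩ := Finset.prod_eq_zero_iff.1 h4.symm
  apply ha l
  rw [hge, hge] at hl
  simp only [Pi.sub_apply, sub_mul, Finset.sum_sub_distrib]
  rw [sub_eq_zero] at hl ⊢
  simp only [mul_comm] at hl ⊢
  rw [hl]

end AuxCov


namespace AuxCov

variable {M : ℕ} {B : Set (Fin M → ℂ)} (X : AuxCov B)

/-- admissible polynomials -/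
def Adm (K : Set (Fin M → ℂ)) (k : ℕ) (Mb : ℝ) (q : MvPolynomial (Fin M) ℂ) : Prop :=
  1 ≤ k ∧ 1 ≤ Mb ∧ (∀ w ∈ K, ‖eval w q‖ ≤ 1) ∧ ∀ w ∈ B, ‖eval w q‖ ≤ Mb * (1 + ‖X.π w‖) ^ k

/-- good points: local bound with a gain in the exponent -/
def Good (K : Set (Fin M → ℂ)) (y0 : Fin X.m → ℂ) (t0 : ℂ) : Prop :=
  ∃ θ : ℝ, 0 < θ ∧ θ ≤ 1 ∧ ∃ C : ℝ, 1 ≤ C ∧ ∀ᶠ p in 𝓝 (y0, t0),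
    X.P.eval₂ (eval p.1) p.2 = 0 → eval p.1 X.D ≠ 0 → ∀ k Mb q, X.Adm K k Mb q →
      ‖eval (X.sg p.1 p.2) q‖ ≤ C ^ k * Mb ^ (1 - θ)

theorem good_calc {H C C1 Mb θ τ x : ℝ} {k : ℕ} (hH : 1 ≤ H) (hC : 1 ≤ C) (hC1 : 1 ≤ C1)
    (hMb : 1 ≤ Mb) (hk : 1 ≤ k) (hτ : 0 < τ) (hτ1 : τ < 1)
    (h : x ≤ H * ((C ^ k * Mb ^ (1 - θ)) ^ τ * (Mb * C1 ^ k) ^ (1 - τ))) :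
    x ≤ (H * C * C1) ^ k * Mb ^ (1 - θ * τ) := by
  refine h.trans ?_
  have hMb0 : 0 < Mb := by linarith
  rw [Real.mul_rpow (by positivity) (by positivity), Real.mul_rpow (by positivity) (by positivity)]
  rw [← Real.rpow_mul hMb0.le]
  have e1 : Mb ^ ((1 - θ) * τ) * Mb ^ (1 - τ) = Mb ^ (1 - θ * τ) := by
    rw [← Real.rpow_add hMb0]; congr 1; ring
  have h1 : H ≤ H ^ k := le_self_pow₀ hH (by omega)
  have h2 : (C ^ k) ^ τ ≤ C ^ k := by
    conv_rhs => rw [← Real.rpow_one (C ^ k)]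
    exact Real.rpow_le_rpow_of_exponent_le (one_le_pow₀ hC) hτ1.le
  have h3 : (C1 ^ k) ^ (1 - τ) ≤ C1 ^ k := by
    conv_rhs => rw [← Real.rpow_one (C1 ^ k)]
    exact Real.rpow_le_rpow_of_exponent_le (one_le_pow₀ hC1) (by linarith)
  calc H * ((C ^ k) ^ τ * Mb ^ ((1 - θ) * τ) * (Mb ^ (1 - τ) * (C1 ^ k) ^ (1 - τ)))
      = H * (C ^ k) ^ τ * (C1 ^ k) ^ (1 - τ) * (Mb ^ ((1 - θ) * τ) * Mb ^ (1 - τ)) := by ring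
    _ ≤ H ^ k * C ^ k * C1 ^ k * Mb ^ (1 - θ * τ) := by
        rw [e1]
        gcongr
    _ = _ := by ring

theorem good_LC (K : Set (Fin M → ℂ)) : X.LC (X.Good K) := by
  intro y0 hy0 t0 ht0
  by_cases hg : X.Good K y0 t0
  · obtain ⟨θ, h1, h2, C, h3, h4⟩ := hg
    filter_upwards [eventually_eventually_nhds.2 h4] with p hp _
    exact ⟨fun _ => ⟨θ, h1, h2, C, h3, h4⟩, fun _ => ⟨θ, h1, h2, C, h3, hp⟩⟩
  obtain ⟨τ, hτa, hτ0, hτ⟩ := aux_sheet X.P y0 t0 ((X.mem_rts _ _).1 ht0)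
    (X.sep y0 t0 ((X.mem_rts _ _).1 ht0) hy0)
  have hroot : ∀ᶠ y in 𝓝 y0, X.P.eval₂ (eval y) (τ y) = 0 := by
    have hc : Tendsto (fun y => (y, τ y)) (𝓝 y0) (𝓝 (y0, t0)) := by
      have := hτa.continuousAt.tendsto
      rw [hτ0] at this
      exact tendsto_id.prodMk_nhds this
    filter_upwards [hc.eventually hτ] with y h
    exact h.2 rfl
  obtain ⟨ρ, hρ, hball⟩ := Metric.eventually_nhds_iff_ball.1
    ((hτa.eventually_analyticAt.and (X.D_nhds hy0)).and hroot)
  have hfst : ∀ᶠ p : (Fin X.m → ℂ) × ℂ in 𝓝 (y0, t0), p.1 ∈ ball y0 (ρ / 5) :=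
    (continuous_fst.tendsto (y0, t0)).eventually (ball_mem_nhds y0 (by positivity))
  filter_upwards [hτ, hfst] with ⟨y1, t1⟩ hp1 hp2 hP
  simp only at hp1 hp2 hP ⊢
  refine ⟨fun hgood => ?_, fun h => absurd h hg⟩
  have ht1 : τ y1 = t1 := hp1.1 hP
  obtain ⟨θ, hθ, hθ1, C, hC, hev⟩ := hgood
  have hy1 : y1 ∈ ball y0 ρ := ball_subset_ball (by linarith) hp2
  have hc1 : Tendsto (fun y => (y, τ y)) (𝓝 y1) (𝓝 (y1, t1)) := by
    have := (hball y1 hy1).1.1.continuousAt.tendsto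
    rw [ht1] at this
    exact tendsto_id.prodMk_nhds this
  obtain ⟨ε, hε, hεb⟩ := Metric.eventually_nhds_iff_ball.1 (hc1.eventually hev)
  have hr : 0 < min 1 (ε / ρ) := by positivity
  obtain ⟨σ, hσ, hσ1, H, hH, htwo⟩ := aux_two_const hr (min_le_left _ _)
  have hC1 : 1 ≤ 1 + ‖y0‖ + ρ := by linarith [norm_nonneg y0]
  refine ⟨θ * σ, by positivity, by nlinarith, H * C * (1 + ‖y0‖ + ρ), ?_, ?_⟩
  · exact one_le_mul_of_one_le_of_one_le (one_le_mul_of_one_le_of_one_le hH hC) hC1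
  filter_upwards [hτ, hfst] with ⟨y, t⟩ hq1 hq2 hPy hDy k Mb q hadm
  simp only at hq1 hq2 hPy hDy ⊢
  obtain ⟨hk, hMb, hK, hqB⟩ := hadm
  have hty : τ y = t := hq1.1 hPy
  rw [← hty]
  set γ : ℂ → (Fin X.m → ℂ) := fun l => y1 + l • (y - y1) with hγ
  have hyy : ‖y - y1‖ < 2 * ρ / 5 := by
    rw [← dist_eq_norm]
    calc dist y y1 ≤ dist y y0 + dist y1 y0 := dist_triangle_right _ _ _
      _ < ρ / 5 + ρ / 5 := add_lt_add hq2 hp2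
      _ = _ := by ring
  have hγb : ∀ l : ℂ, ‖l‖ < 2 → γ l ∈ ball y0 ρ := by
    intro l hl
    rw [mem_ball, dist_eq_norm]
    have e : γ l - y0 = (y1 - y0) + l • (y - y1) := by simp [hγ]; abel
    rw [e]
    have h1 : ‖y1 - y0‖ < ρ / 5 := by rw [← dist_eq_norm]; exact hp2
    have h2 : ‖l • (y - y1)‖ ≤ 2 * (2 * ρ / 5) := by
      rw [norm_smul]
      exact mul_le_mul hl.le hyy.le (norm_nonneg _) (by norm_num)
    linarith [norm_add_le (y1 - y0) (l • (y - y1))]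
  have hγa : ∀ l, AnalyticAt ℂ γ l := fun l => by
    refine analyticAt_const.add (analyticAt_id.smul analyticAt_const)
  have key := htwo (fun l => eval (X.sg (γ l) (τ (γ l))) q) (C ^ k * Mb ^ (1 - θ))
    (Mb * (1 + ‖y0‖ + ρ) ^ k) (by positivity) (by positivity) ?_ ?_ ?_
  · have e1 : γ 1 = y := by simp [hγ]
    simp only [e1] at key
    exact good_calc hH hC hC1 hMb hk hσ hσ1 key
  · intro l hl
    obtain ⟨⟨ha, hD⟩, -⟩ := hball _ (hγb l hl)
    have h1 : AnalyticAt ℂ (fun l => (γ l, τ (γ l))) l :=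
      AnalyticAt.prod (hγa l) (AnalyticAt.fun_comp ha (hγa l))
    exact (AnalyticAt.fun_comp (g := fun p : (Fin X.m → ℂ) × ℂ => eval (X.sg p.1 p.2) q)
      (f := fun l => (γ l, τ (γ l))) (X.q_sg_analytic q hD (τ (γ l))) h1).differentiableAt
  · intro l hl
    have hin := hγb l hl
    obtain ⟨⟨ha, hD⟩, hP'⟩ := hball _ hin
    obtain ⟨hs1, hs2, -⟩ := X.sg_spec hD ((X.mem_rts _ _).2 hP')
    have := hqB _ hs1
    rw [hs2] at this
    refine this.trans ?_
    refine mul_le_mul_of_nonneg_left (pow_le_pow_left₀ (by positivity) ?_ _) (by linarith)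
    have h5 : ‖γ l‖ ≤ ‖y0‖ + ‖γ l - y0‖ := by
      have := norm_add_le y0 (γ l - y0); simpa using this
    rw [mem_ball, dist_eq_norm] at hin
    linarith
  · intro l hl
    have hl2 : ‖l‖ < 2 := by linarith [min_le_left 1 (ε / ρ)]
    obtain ⟨⟨ha, hD⟩, hP'⟩ := hball _ (hγb l hl2)
    refine hεb (γ l) ?_ hP' hD k Mb q ⟨hk, hMb, hK, hqB⟩
    rw [mem_ball, dist_eq_norm]
    have e : γ l - y1 = l • (y - y1) := by simp [hγ]
    rw [e, norm_smul]
    calc ‖l‖ * ‖y - y1‖ ≤ (ε / ρ) * (2 * ρ / 5) :=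
          mul_le_mul (hl.trans (min_le_right _ _)) hyy.le (norm_nonneg _) (by positivity)
      _ = 2 / 5 * ε := by field_simp
      _ < ε := by linarith

theorem all_good
    (hprime : ∀ p q : MvPolynomial (Fin M) ℂ, (∀ w ∈ B, eval w p * eval w q = 0) →
      (∀ w ∈ B, eval w p = 0) ∨ (∀ w ∈ B, eval w q = 0))
    (K : Set (Fin M → ℂ)) (b : Fin M → ℂ) (hb : b ∈ B) (δ : ℝ) (hδ : 0 < δ)
    (hK : ∀ w ∈ B, dist w b < δ → w ∈ K) (y : Fin X.m → ℂ) (hy : eval y X.D ≠ 0) (t : ℂ)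
    (ht : t ∈ X.rts y) : X.Good K y t := by
  classical
  obtain ⟨w1, ⟨hw1, hD1⟩, hd1⟩ := Metric.mem_closure_iff.1 (X.dense hprime b hb) δ hδ
  have hg1 : X.Good K (X.π w1) (eval w1 X.u) := by
    refine ⟨1, one_pos, le_rfl, 1, le_rfl, ?_⟩
    have hc := (X.sg_analytic hD1 (eval w1 X.u)).continuousAt.tendsto
    simp only [X.sg_u hw1 hD1] at hc
    have hn : ∀ᶠ w in 𝓝 w1, dist w b < δ := by
      refine isOpen_ball.mem_nhds ?_
      rw [mem_ball, dist_comm]; exact hd1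
    filter_upwards [hc.eventually hn] with p hp hP hD k Mb q hadm
    have hs := X.sg_spec hD ((X.mem_rts _ _).2 hP)
    simpa using hadm.2.2.1 _ (hK _ hs.1 hp)
  obtain ⟨p1, hp1⟩ := X.theta _ (X.good_LC K) X.u
  obtain ⟨N, hN, hNG⟩ : ∃ N, X.LC N ∧ ∀ y t, N y t ↔ ¬ X.Good K y t :=
    ⟨_, X.LC_not (X.good_LC K), fun _ _ => Iff.rfl⟩
  obtain ⟨p2, hp2⟩ := X.theta N hN X.u
  obtain ⟨r1, hr1⟩ := X.pull p1 X.u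
  obtain ⟨r2, hr2⟩ := X.pull p2 X.u
  have h1 : ∀ w ∈ B, eval (X.π w) X.D ≠ 0 →
      (eval w r1 = ∏ t ∈ (X.rts (X.π w)).filter (X.Good K (X.π w)), (eval w X.u - t)) := by
    intro w hw hD
    rw [hr1, hp1 _ (by simpa using hD)]
    refine Finset.prod_congr rfl fun t ht => ?_
    simp only [Option.elim]
    rw [(X.sg_spec hD (Finset.mem_filter.1 ht).1).2.2]
  have h2 : ∀ w ∈ B, eval (X.π w) X.D ≠ 0 →
      (eval w r2 = ∏ t ∈ (X.rts (X.π w)).filter (N (X.π w)), (eval w X.u - t)) := by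
    intro w hw hD
    rw [hr2, hp2 _ (by simpa using hD)]
    refine Finset.prod_congr rfl fun t ht => ?_
    simp only [Option.elim]
    rw [(X.sg_spec hD (Finset.mem_filter.1 ht).1).2.2]
  have h12 : ∀ w ∈ B, eval w r1 * eval w r2 = 0 := by
    intro w hw
    rw [← map_mul]
    revert w
    apply X.zero_of_generic hprime
    intro w hw hD
    rw [map_mul, h1 w hw hD, h2 w hw hD]
    by_cases hg : X.Good K (X.π w) (eval w X.u)
    · rw [Finset.prod_eq_zero (Finset.mem_filter.2 ⟨X.u_mem hw, hg⟩) (sub_self _), zero_mul]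
    · rw [mul_comm, Finset.prod_eq_zero (Finset.mem_filter.2 ⟨X.u_mem hw, (hNG _ _).2 hg⟩) (sub_self _), zero_mul]
  obtain ⟨hs1, hs2, hs3⟩ := X.sg_spec hy ht
  rcases hprime _ _ h12 with h | h
  · have h3 := h _ hs1
    rw [h1 _ hs1 (by rw [hs2]; exact hy), hs2, hs3] at h3
    obtain ⟨t', ht', he⟩ := Finset.prod_eq_zero_iff.1 h3
    rw [sub_eq_zero.1 he]
    exact (Finset.mem_filter.1 ht').2
  · have h3 := h _ hw1
    rw [h2 _ hw1 hD1] at h3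
    obtain ⟨t', ht', he⟩ := Finset.prod_eq_zero_iff.1 h3
    rw [sub_eq_zero.1 he] at hg1
    exact absurd hg1 ((hNG _ _).1 (Finset.mem_filter.1 ht').2)

end AuxCov


namespace AuxCov

variable {M : ℕ} {B : Set (Fin M → ℂ)} (X : AuxCov B)

theorem unif_good (K : Set (Fin M → ℂ))
    (y0 : Fin X.m → ℂ) (hy0 : eval y0 X.D ≠ 0) (hgood : ∀ t ∈ X.rts y0, X.Good K y0 t) :
    ∃ θ : ℝ, 0 < θ ∧ θ ≤ 1 ∧ ∃ C : ℝ, 1 ≤ C ∧ ∃ r : ℝ, 0 < r ∧ ∀ y ∈ ball y0 r,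
      eval y X.D ≠ 0 ∧ ∀ t ∈ X.rts y, ∀ k Mb q, X.Adm K k Mb q →
        ‖eval (X.sg y t) q‖ ≤ C ^ k * Mb ^ (1 - θ) := by
  have hgood' := hgood
  choose! θ hθ hθ1 C hC hev using hgood'
  obtain ⟨τ, hτ, hnear⟩ := X.sheets hy0
  set S := X.rts y0
  have hsum : 0 ≤ ∑ t ∈ S, (θ t)⁻¹ := Finset.sum_nonneg fun t ht => (inv_pos.2 (hθ t ht)).le
  have hCs : 0 ≤ ∑ t ∈ S, C t := Finset.sum_nonneg fun t ht => by linarith [hC t ht]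
  have hθle : ∀ t ∈ S, (1 + ∑ t ∈ S, (θ t)⁻¹)⁻¹ ≤ θ t := by
    intro t ht
    rw [inv_le_comm₀ (by linarith) (hθ t ht)]
    have := Finset.single_le_sum (f := fun t => (θ t)⁻¹) (fun t ht => (inv_pos.2 (hθ t ht)).le) ht
    linarith
  have hCle : ∀ t ∈ S, C t ≤ 1 + ∑ t ∈ S, C t := by
    intro t ht
    have := Finset.single_le_sum (f := C) (fun t ht => by linarith [hC t ht]) ht
    linarith
  refine ⟨(1 + ∑ t ∈ S, (θ t)⁻¹)⁻¹, by positivity, inv_le_one_of_one_le₀ (by linarith),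
    1 + ∑ t ∈ S, C t, by linarith, ?_⟩
  have hall : ∀ᶠ y in 𝓝 y0, ∀ t ∈ S, X.P.eval₂ (eval y) (τ t y) = 0 → eval y X.D ≠ 0 →
      ∀ k Mb q, X.Adm K k Mb q → ‖eval (X.sg y (τ t y)) q‖ ≤ C t ^ k * Mb ^ (1 - θ t) := by
    rw [Finset.eventually_all]
    intro t ht
    have hc : Tendsto (fun y => (y, τ t y)) (𝓝 y0) (𝓝 (y0, t)) := by
      have := (hτ t ht).1.continuousAt.tendsto
      rw [(hτ t ht).2.1] at this
      exact tendsto_id.prodMk_nhds this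
    exact hc.eventually (hev t ht)
  obtain ⟨r, hr, hb⟩ := Metric.eventually_nhds_iff_ball.1 (hnear.and hall)
  refine ⟨r, hr, fun y hy => ?_⟩
  obtain ⟨⟨hD, himg, -⟩, hbd⟩ := hb y hy
  refine ⟨hD, fun t' ht' k Mb q hadm => ?_⟩
  have ht'' := ht'
  rw [himg] at ht''
  obtain ⟨t, ht, rfl⟩ := Finset.mem_image.1 ht''
  refine (hbd t ht ((X.mem_rts _ _).1 ht') hD k Mb q hadm).trans ?_
  have hMb := hadm.2.1
  have h0 : 0 ≤ C t := by linarith [hC t ht]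
  refine mul_le_mul (pow_le_pow_left₀ h0 (hCle t ht) _) ?_ (by positivity) (by positivity)
  exact Real.rpow_le_rpow_of_exponent_le hMb (by linarith [hθle t ht])

theorem line_bound (K : Set (Fin M → ℂ)) (yc : Fin X.m → ℂ) (r A Mb : ℝ) (k : ℕ)
    (q : MvPolynomial (Fin M) ℂ) (hr : 0 < r) (hA : 0 < A) (hMb : 1 ≤ Mb)
    (hball : ∀ y ∈ ball yc r, eval y X.D ≠ 0 ∧ ∀ t ∈ X.rts y, ‖eval (X.sg y t) q‖ ≤ A)
    (hq : ∀ w ∈ B, ‖eval w q‖ ≤ Mb * (1 + ‖X.π w‖) ^ k)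
    (y : Fin X.m → ℂ) (hy : eval y X.D ≠ 0) (t : ℂ) (ht : t ∈ X.rts y) :
    ‖eval (X.sg y t) q‖ ≤ A * ((1 + (1 + ‖yc‖) / r) * (1 + ‖y‖)) ^ k := by
  classical
  set v := y - yc with hv
  set γ : ℂ → (Fin X.m → ℂ) := fun l => yc + l • v with hγ
  have hDc : eval yc X.D ≠ 0 := (hball yc (mem_ball_self hr)).1
  obtain ⟨F, hF⟩ := aux_line_zeros X.D yc v (l₀ := 0) (by simpa using hDc)
  have hDF : ∀ l, l ∉ F → eval (γ l) X.D ≠ 0 := fun l hl h => hl ((hF l).1 h)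
  set s : ℝ := (X.P.natDegree : ℝ) with hs
  have hs0 : 0 ≤ s := by positivity
  set L : ℝ := 1 + ‖yc‖ + ‖v‖ with hL
  have hL1 : 1 ≤ L := by linarith [norm_nonneg yc, norm_nonneg v]
  have hγn : ∀ l, 1 + ‖γ l‖ ≤ L * (1 + ‖l‖) := by
    intro l
    have h1 : ‖γ l‖ ≤ ‖yc‖ + ‖l‖ * ‖v‖ := by
      rw [← norm_smul]; exact norm_add_le _ _
    nlinarith [norm_nonneg yc, norm_nonneg v, norm_nonneg l, mul_nonneg (norm_nonneg yc) (norm_nonneg l)]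
  have hγa : ∀ l, AnalyticAt ℂ γ l := fun l => by
    refine analyticAt_const.add (analyticAt_id.smul analyticAt_const)
  set ρ : ℝ := 1 + (1 + ‖v‖) / r with hρ
  have hρ1 : 1 ≤ ρ := by
    have : 0 ≤ (1 + ‖v‖) / r := by positivity
    linarith
  have hγ1 : γ 1 = y := by simp [hγ, hv]
  have h1F : (1 : ℂ) ∉ F := fun h => hy (by rw [← hγ1]; exact (hF 1).2 h)
  have hsumle : ∀ (y' : Fin X.m → ℂ) (E : ℝ) (n : ℕ), eval y' X.D ≠ 0 →
      (∀ t ∈ X.rts y', ‖eval (X.sg y' t) q‖ ≤ E) →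
      ‖∑ t ∈ X.rts y', (eval (X.sg y' t) q) ^ n‖ ≤ s * E ^ n := by
    intro y' E n hD h
    refine (norm_sum_le _ _).trans ?_
    calc ∑ t ∈ X.rts y', ‖(eval (X.sg y' t) q) ^ n‖ ≤ ∑ t ∈ X.rts y', E ^ n := by
          refine Finset.sum_le_sum fun t ht => ?_
          rw [norm_pow]
          exact pow_le_pow_left₀ (norm_nonneg _) (h t ht) _
      _ = s * E ^ n := by rw [Finset.sum_const, X.card_rts hD, nsmul_eq_mul]
  have hpow : ∀ n : ℕ, ‖∑ t ∈ X.rts y, (eval (X.sg y t) q) ^ n‖ ≤ ((k:ℝ) * n + 1) * (s * (A * ρ ^ k) ^ n) := by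
    intro n
    have key := aux_bw F (fun l => ∑ t ∈ X.rts (γ l), (eval (X.sg (γ l) t) q) ^ n)
      (C := s * (Mb * L ^ k) ^ n) (n := k * n) (r := r / (1 + ‖v‖)) (A := s * A ^ n) (ρ := ρ) (z := 1)
      ?_ ?_ (by positivity) ?_ hρ1 h1F ?_
    · simp only [hγ1] at key
      refine key.trans (le_of_eq ?_)
      push_cast
      rw [mul_pow, ← pow_mul]
      ring
    · intro l hl
      have h1 := (X.prod_analytic (fun _ _ => True) X.LC_true γ
        (fun z => (eval (X.sg (γ z.1) z.2) q) ^ n) l (hγa l) (hDF l hl) ?_).2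
      · simp only [Finset.filter_true] at h1
        exact h1.differentiableAt
      · intro t ht
        refine AnalyticAt.pow ?_ n
        refine AnalyticAt.fun_comp (g := fun p : (Fin X.m → ℂ) × ℂ => eval (X.sg p.1 p.2) q)
          (f := fun z : ℂ × ℂ => (γ z.1, z.2)) (X.q_sg_analytic q (hDF l hl) t) ?_
        exact AnalyticAt.prod (AnalyticAt.fun_comp (f := Prod.fst) (hγa _) analyticAt_fst) analyticAt_snd
    · intro l hl
      have := hsumle (γ l) (Mb * (1 + ‖γ l‖) ^ k) n (hDF l hl) (fun t ht => by
        obtain ⟨hs1, hs2, -⟩ := X.sg_spec (hDF l hl) ht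
        have := hq _ hs1
        rwa [hs2] at this)
      refine this.trans ?_
      calc s * (Mb * (1 + ‖γ l‖) ^ k) ^ n ≤ s * (Mb * (L * (1 + ‖l‖)) ^ k) ^ n := by
            gcongr
            exact hγn l
        _ = _ := by rw [mul_pow L, pow_mul, ← mul_assoc, mul_pow _ _ n]; ring
    · intro l hl hlr
      refine hsumle (γ l) A n (hDF l hl) (hball (γ l) ?_).2
      rw [mem_ball, dist_eq_norm]
      have e : γ l - yc = l • v := by simp [hγ]
      rw [e, norm_smul]
      calc ‖l‖ * ‖v‖ ≤ r / (1 + ‖v‖) * ‖v‖ := by gcongr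
        _ < r := by
          rw [div_mul_eq_mul_div, div_lt_iff₀ (by positivity)]
          nlinarith [norm_nonneg v]
    · rw [norm_one, hρ, mul_add, div_mul_div_cancel₀ (by positivity), div_self hr.ne']
      have : 0 ≤ r / (1 + ‖v‖) * 1 := by positivity
      linarith
  have hfin := aux_powersum (X.rts y) (fun t => eval (X.sg y t) q) (B := A * ρ ^ k) (by positivity)
    hpow ht
  refine hfin.trans ?_
  gcongr
  have h2 : 1 + ‖v‖ ≤ (1 + ‖yc‖) * (1 + ‖y‖) := by
    have := norm_sub_le y yc
    nlinarith [norm_nonneg yc, norm_nonneg y, mul_nonneg (norm_nonneg yc) (norm_nonneg y)]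
  calc ρ = 1 + (1 + ‖v‖) / r := rfl
    _ ≤ (1 + ‖y‖) + ((1 + ‖yc‖) * (1 + ‖y‖)) / r := by
        gcongr
        linarith [norm_nonneg y]
    _ = _ := by ring

theorem final_bound (X : AuxCov B)
    (hprime : ∀ p q : MvPolynomial (Fin M) ℂ, (∀ w ∈ B, eval w p * eval w q = 0) →
      (∀ w ∈ B, eval w p = 0) ∨ (∀ w ∈ B, eval w q = 0))
    (K : Set (Fin M → ℂ)) (b : Fin M → ℂ) (hb : b ∈ B) (δ : ℝ) (hδ : 0 < δ)
    (hK : ∀ w ∈ B, dist w b < δ → w ∈ K) :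
    ∃ C : ℝ, 1 ≤ C ∧ ∀ (q : MvPolynomial (Fin M) ℂ) (k : ℕ), 1 ≤ k → q.totalDegree ≤ k →
      (∀ w ∈ K, ‖eval w q‖ ≤ 1) → ∀ w ∈ B, ‖eval w q‖ ≤ (C * (1 + ‖w‖)) ^ k := by
  obtain ⟨yc, hyc⟩ := aux_exists_ne X.D_ne
  obtain ⟨θ, hθ, hθ1, C, hC, r, hr, hball⟩ := X.unif_good K yc hyc
    (fun t ht => X.all_good hprime K b hb δ hδ hK yc hyc t ht)
  set C5 := 1 + (1 + ‖yc‖) / r with hC5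
  have hC51 : 1 ≤ C5 := by
    have : 0 ≤ (1 + ‖yc‖) / r := by positivity
    linarith
  set E := C * C5 with hE
  have hE1 : 1 ≤ E := one_le_mul_of_one_le_of_one_le hC hC51
  have step : ∀ q k Mb, X.Adm K k Mb q → ∀ w ∈ B, ‖eval w q‖ ≤ (E ^ k * Mb ^ (1 - θ)) * (1 + ‖X.π w‖) ^ k := by
    intro q k Mb hadm
    have hMb := hadm.2.1
    have hcl : IsClosed {w : Fin M → ℂ | ‖eval w q‖ ≤ (E ^ k * Mb ^ (1 - θ)) * (1 + ‖X.π w‖) ^ k} := by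
      refine isClosed_le (MvPolynomial.continuous_eval q).norm ?_
      have := X.π.continuous_of_finiteDimensional
      fun_prop
    intro w hw
    have hmem := X.dense hprime w hw
    refine (closure_minimal ?_ hcl) hmem
    rintro w' ⟨hw', hD'⟩
    change ‖eval w' q‖ ≤ _
    have h1 := X.line_bound K yc r (C ^ k * Mb ^ (1 - θ)) Mb k q hr (by positivity) hMb
      (fun y hy => ⟨(hball y hy).1, fun t ht => (hball y hy).2 t ht k Mb q hadm⟩) hadm.2.2.2
      (X.π w') hD' _ (X.u_mem hw')
    rw [X.sg_u hw' hD'] at h1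
    refine h1.trans (le_of_eq ?_)
    rw [hE, mul_pow, mul_pow]
    ring
  set πc := LinearMap.toContinuousLinearMap X.π with hπc
  set G := E ^ (1 / θ) with hG
  have hG1 : 1 ≤ G := Real.one_le_rpow hE1 (by positivity)
  refine ⟨G * (1 + ‖πc‖), one_le_mul_of_one_le_of_one_le hG1 (by linarith [norm_nonneg πc]), ?_⟩
  intro q k hk hdeg hqK
  obtain ⟨A0, hA0, hgr⟩ := X.growth_q q k hdeg
  set S : Set ℝ := {m | 1 ≤ m ∧ ∀ w ∈ B, ‖eval w q‖ ≤ m * (1 + ‖X.π w‖) ^ k} with hS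
  have hSne : S.Nonempty := ⟨max 1 A0, le_max_left _ _, fun w hw => (hgr w hw).trans (by
    gcongr; exact le_max_right _ _)⟩
  have hSbdd : BddBelow S := ⟨1, fun m hm => hm.1⟩
  set m := sInf S with hm
  have hm1 : 1 ≤ m := le_csInf hSne fun m hm => hm.1
  have hmB : ∀ w ∈ B, ‖eval w q‖ ≤ m * (1 + ‖X.π w‖) ^ k := by
    intro w hw
    have hp : 0 < (1 + ‖X.π w‖) ^ k := by positivity
    rw [← div_le_iff₀ hp]
    refine le_csInf hSne fun m hm => ?_
    rw [div_le_iff₀ hp]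
    exact hm.2 w hw
  have hmem : E ^ k * m ^ (1 - θ) ∈ S :=
    ⟨one_le_mul_of_one_le_of_one_le (one_le_pow₀ hE1) (Real.one_le_rpow hm1 (by linarith)),
      step q k m ⟨hk, hm1, hqK, hmB⟩⟩
  have hle : m ≤ E ^ k * m ^ (1 - θ) := csInf_le hSbdd hmem
  have hm0 : 0 < m := by linarith
  have hmθ : m ^ θ ≤ E ^ k := by
    have e : m = m ^ θ * m ^ (1 - θ) := by
      rw [← Real.rpow_add hm0]; simp
    have hpos : 0 < m ^ (1 - θ) := by positivity
    rw [e] at hle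
    conv at hle => rhs; rw [← e]
    exact le_of_mul_le_mul_right hle hpos
  have hmG : m ≤ G ^ k := by
    have h1 : (m ^ θ) ^ (1 / θ) ≤ (E ^ k) ^ (1 / θ) := Real.rpow_le_rpow (by positivity) hmθ (by positivity)
    rw [← Real.rpow_mul hm0.le, mul_one_div_cancel hθ.ne', Real.rpow_one] at h1
    refine h1.trans (le_of_eq ?_)
    rw [hG, ← Real.rpow_natCast, ← Real.rpow_natCast, ← Real.rpow_mul (by linarith), ← Real.rpow_mul (by linarith), mul_comm]
  intro w hw
  refine (hmB w hw).trans ?_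
  calc m * (1 + ‖X.π w‖) ^ k ≤ G ^ k * ((1 + ‖πc‖) * (1 + ‖w‖)) ^ k := by
        gcongr
        have : ‖X.π w‖ ≤ ‖πc‖ * ‖w‖ := πc.le_opNorm w
        nlinarith [norm_nonneg πc, norm_nonneg w]
    _ = _ := by rw [← mul_pow, mul_assoc]

end AuxCov


theorem aux_final {N M : ℕ} (A : Set (EuclideanSpace ℂ (Fin N)))
    (f : EuclideanSpace ℂ (Fin N) → EuclideanSpace ℂ (Fin M)) (d C R : ℝ) (hC : 0 < C) (hR : 0 < R)
    (h : ∀ z ∈ A, R < ‖z‖ → C * ‖z‖ ^ d < ‖f z‖) :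
    (d : EReal) ≤ Filter.liminf (logRatio f) (atInftyOn A) ∧ (d : EReal) ≤ lojExp f A := by
  refine ⟨?_, le_sSup ⟨d, rfl, C, hC, R, hR, h⟩⟩
  rw [Filter.le_liminf_iff]
  intro y hy
  obtain ⟨d', hd1, hd2⟩ := EReal.lt_iff_exists_real_btwn.1 hy
  have hd2' : d' < d := by exact_mod_cast hd2
  have hlog : ∀ᶠ x : ℝ in atTop, R < x ∧ 1 < x ∧ -Real.log C ≤ (d - d') * Real.log x := by
    refine (eventually_gt_atTop R).and ((eventually_gt_atTop 1).and ?_)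
    exact (Tendsto.const_mul_atTop (by linarith) Real.tendsto_log_atTop).eventually_ge_atTop _
  have h1 : ∀ᶠ z : EuclideanSpace ℂ (Fin N) in atInftyOn A, R < ‖z‖ ∧ 1 < ‖z‖ ∧ -Real.log C ≤ (d - d') * Real.log ‖z‖ :=
    (tendsto_comap.eventually hlog).filter_mono inf_le_left
  have h2 : ∀ᶠ z in atInftyOn A, z ∈ A :=
    (eventually_principal.2 fun z hz => hz).filter_mono inf_le_right
  filter_upwards [h1, h2] with z ⟨hz1, hz2, hz3⟩ hzA
  refine hd1.trans_le ?_
  have hz0 : 0 < ‖z‖ := by linarith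
  have hf := h z hzA hz1
  have hf0 : 0 < ‖f z‖ := lt_trans (by positivity) hf
  have hlz : 0 < Real.log ‖z‖ := Real.log_pos hz2
  rw [logRatio, elog, elog, if_neg hf0.ne', if_neg hz0.ne', ← EReal.coe_div, EReal.coe_le_coe_iff,
    le_div_iff₀ hlz]
  have h3 := Real.log_le_log (by positivity) hf.le
  rw [Real.log_mul hC.ne' (by positivity), Real.log_rpow hz0] at h3
  linarith

theorem aux_coord (N : ℕ) : ∃ c : ℝ, 1 ≤ c ∧ ∀ z : EuclideanSpace ℂ (Fin N), 0 < ‖z‖ →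
    ∃ i, ‖z‖ ≤ c * ‖z i‖ := by
  refine ⟨N + 1, by linarith [Nat.cast_nonneg (α := ℝ) N], fun z hz => ?_⟩
  by_contra hcon
  push Not at hcon
  have h1 : ‖z‖ ^ 2 = ∑ i, ‖z i‖ ^ 2 := EuclideanSpace.norm_sq_eq z
  have h2 : ∑ i, ‖z i‖ ^ 2 ≤ (∑ i, ‖z i‖) ^ 2 :=
    Finset.sum_sq_le_sq_sum_of_nonneg fun i _ => norm_nonneg _
  have h3 : ‖z‖ ≤ ∑ i, ‖z i‖ := by
    refine le_of_sq_le_sq ?_ (Finset.sum_nonneg fun i _ => norm_nonneg _)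
    linarith
  have h4 : ∑ i, ‖z i‖ ≤ ∑ i : Fin N, ‖z‖ / (N + 1) := by
    refine Finset.sum_le_sum fun i _ => ?_
    rw [le_div_iff₀ (by positivity), mul_comm]
    exact (hcon i).le
  rw [Finset.sum_const, Finset.card_univ, Fintype.card_fin, nsmul_eq_mul] at h4
  have h5 : (N:ℝ) * (‖z‖ / (N + 1)) < ‖z‖ := by
    rw [mul_div_assoc', div_lt_iff₀ (by positivity)]
    nlinarith
  linarith

theorem aux_mem_vanish {n : ℕ} (A : Set (EuclideanSpace ℂ (Fin n))) (p : MvPolynomial (Fin n) ℂ) :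
    p ∈ vanishIdeal A ↔ ∀ z ∈ A, evalAt z p = 0 := by
  rw [vanishIdeal, RingHom.mem_ker]
  constructor
  · intro h z hz
    exact congrFun h ⟨z, hz⟩
  · intro h
    funext z
    exact h z z.2

theorem aux_upper {M : ℕ} (B : Set (EuclideanSpace ℂ (Fin M)))
    (hBalg : IsAlgebraicSet B) (hBprime : (vanishIdeal B).IsPrime)
    (b : EuclideanSpace ℂ (Fin M)) (hb : b ∈ B) (δ : ℝ) (hδ : 0 < δ) :
    ∃ C : ℝ, 1 ≤ C ∧ ∀ w ∈ B, greenV (B ∩ Metric.closedBall b δ) w ≤ ((Real.log (C * (1 + ‖w‖)) : ℝ) : EReal) := by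
  set B' : Set (Fin M → ℂ) := (WithLp.toLp 2) ⁻¹' B with hB'
  obtain ⟨S, hS⟩ := hBalg
  have hprime : ∀ p q : MvPolynomial (Fin M) ℂ, (∀ w ∈ B', eval w p * eval w q = 0) →
      (∀ w ∈ B', eval w p = 0) ∨ (∀ w ∈ B', eval w q = 0) := by
    intro p q h
    have : p * q ∈ vanishIdeal B := by
      rw [aux_mem_vanish]
      intro z hz
      rw [evalAt, map_mul]
      exact h (WithLp.ofLp z) hz
    rcases hBprime.mem_or_mem this with h1 | h1
    · left
      rw [aux_mem_vanish] at h1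
      exact fun w hw => h1 _ hw
    · right
      rw [aux_mem_vanish] at h1
      exact fun w hw => h1 _ hw
  obtain ⟨X⟩ := aux_structure B' ⟨WithLp.ofLp b, hb⟩ ⟨(S : Set _), by
    ext w
    rw [hB', hS]
    rfl⟩ hprime
  have hcont : Continuous (WithLp.toLp 2 : (Fin M → ℂ) → EuclideanSpace ℂ (Fin M)) :=
    PiLp.continuous_toLp 2 _
  have hnear : ∀ᶠ w in 𝓝 (WithLp.ofLp b), (WithLp.toLp 2 w : EuclideanSpace ℂ (Fin M)) ∈ closedBall b δ :=
    (hcont.tendsto (WithLp.ofLp b)).eventually (closedBall_mem_nhds b hδ)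
  obtain ⟨δ', hδ', hδb⟩ := Metric.eventually_nhds_iff_ball.1 hnear
  obtain ⟨C, hC, hbd⟩ := X.final_bound hprime ((WithLp.toLp 2) ⁻¹' (B ∩ closedBall b δ)) (WithLp.ofLp b) hb δ' hδ'
    (fun w hw hd => ⟨hw, hδb w hd⟩)
  refine ⟨C, hC, fun w hw => sSup_le ?_⟩
  rintro x ⟨q, hq1, hqK, rfl⟩
  rw [EReal.coe_le_coe_iff]
  have h1 := hbd q q.totalDegree hq1 le_rfl (fun v hv => hqK _ hv) (WithLp.ofLp w) hw
  have h2 : ‖WithLp.ofLp w‖ ≤ ‖w‖ := by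
    rw [pi_norm_le_iff_of_nonneg (norm_nonneg _)]
    exact fun i => PiLp.norm_apply_le w i
  have h3 : ‖evalAt w q‖ ≤ (C * (1 + ‖w‖)) ^ q.totalDegree := by
    refine h1.trans ?_
    gcongr
  have hk : (0:ℝ) < q.totalDegree := by exact_mod_cast hq1
  have h4 : 1 ≤ C * (1 + ‖w‖) := one_le_mul_of_one_le_of_one_le hC (by linarith [norm_nonneg w])
  have h5 : 0 ≤ Real.log (C * (1 + ‖w‖)) := Real.log_nonneg h4
  rw [inv_mul_le_iff₀ hk]
  refine max_le ?_ (by positivity)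
  rcases eq_or_lt_of_le (norm_nonneg (evalAt w q)) with h0 | h0
  · rw [← h0, Real.log_zero]; positivity
  · have := Real.log_le_log h0 h3
    rwa [Real.log_pow] at this

theorem aux_lower {N : ℕ} (L : Set (EuclideanSpace ℂ (Fin N))) (hL : IsCompact L) :
    ∃ R : ℝ, 1 ≤ R ∧ ∀ z, 0 < ‖z‖ → ((Real.log (‖z‖ / R) : ℝ) : EReal) ≤ greenV L z := by
  obtain ⟨R0, hR0⟩ := hL.isBounded.exists_norm_le
  obtain ⟨c, hc, hcz⟩ := aux_coord N
  set R := max 1 R0 with hR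
  have hR1 : 1 ≤ R := le_max_left _ _
  have hRp : 0 < R := by linarith
  refine ⟨c * R, one_le_mul_of_one_le_of_one_le hc hR1, fun z hz => ?_⟩
  obtain ⟨i, hi⟩ := hcz z hz
  have hdeg : (MvPolynomial.C ((R:ℂ)⁻¹) * MvPolynomial.X i : MvPolynomial (Fin N) ℂ).totalDegree = 1 := by
    rw [MvPolynomial.C_mul_X_eq_monomial, totalDegree_monomial _ (by
      apply inv_ne_zero; exact_mod_cast hRp.ne')]
    simp
  have hev : ∀ w : EuclideanSpace ℂ (Fin N), ‖evalAt w (MvPolynomial.C ((R:ℂ)⁻¹) * MvPolynomial.X i)‖ = ‖w i‖ / R := by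
    intro w
    rw [evalAt, map_mul, eval_C, eval_X, norm_mul, norm_inv, Complex.norm_real, Real.norm_of_nonneg hRp.le,
      inv_mul_eq_div]
  refine le_trans ?_ (le_sSup ⟨MvPolynomial.C ((R:ℂ)⁻¹) * MvPolynomial.X i, hdeg.ge, ?_, rfl⟩)
  · rw [hdeg, hev, EReal.coe_le_coe_iff, Nat.cast_one, inv_one, one_mul]
    refine le_max_of_le_left (Real.log_le_log (by positivity) ?_)
    rw [← div_div]
    gcongr
    rw [div_le_iff₀ (by linarith), mul_comm]
    exact hi
  · intro w hw
    rw [hev, div_le_one hRp]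
    exact (PiLp.norm_apply_le w i).trans ((hR0 w hw).trans (le_max_right _ _))

theorem aux_main {N M : ℕ} (A : Set (EuclideanSpace ℂ (Fin N)))
    (f : EuclideanSpace ℂ (Fin N) → EuclideanSpace ℂ (Fin M))
    (hBalg : IsAlgebraicSet (f '' A)) (hBprime : (vanishIdeal (f '' A)).IsPrime)
    (b : EuclideanSpace ℂ (Fin M)) (hb : b ∈ f '' A) (δ : ℝ) (hδ : 0 < δ)
    (hKpre : IsCompact (A ∩ f ⁻¹' (f '' A ∩ Metric.closedBall b δ)))
    (d : ℝ) (hd : 0 < d)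
    (hineq : ∀ z ∈ A,
      (d : EReal) * greenV (A ∩ f ⁻¹' (f '' A ∩ Metric.closedBall b δ)) z ≤
        greenV (f '' A ∩ Metric.closedBall b δ) (f z)) :
    (d : EReal) ≤ Filter.liminf (logRatio f) (atInftyOn A) ∧ (d : EReal) ≤ lojExp f A := by
  obtain ⟨C, hC, hup⟩ := aux_upper (f '' A) hBalg hBprime b hb δ hδ
  obtain ⟨R, hR, hlow⟩ := aux_lower _ hKpre
  have hRp : 0 < R := by linarith
  have hkey : ∀ z ∈ A, 0 < ‖z‖ → (‖z‖ / R) ^ d ≤ C * (1 + ‖f z‖) := by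
    intro z hz hz0
    have h1 : ((d * Real.log (‖z‖ / R) : ℝ) : EReal) ≤ ((Real.log (C * (1 + ‖f z‖)) : ℝ) : EReal) := by
      refine le_trans ?_ ((hineq z hz).trans (hup _ ⟨z, hz, rfl⟩))
      rw [EReal.coe_mul]
      exact mul_le_mul_of_nonneg_left (hlow z hz0) (by exact_mod_cast hd.le)
    rw [EReal.coe_le_coe_iff, ← Real.log_rpow (by positivity)] at h1
    exact (Real.log_le_log_iff (by positivity) (by positivity)).1 h1
  set c1 := (1 / R) ^ d / C with hc1
  have hc1p : 0 < c1 := by positivity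
  refine aux_final A f d (c1 / 2) (max 1 ((2 / c1) ^ (1 / d))) (by positivity) (by positivity) ?_
  intro z hz hzR
  have hz1 : 1 < ‖z‖ := (le_max_left _ _).trans_lt hzR
  have hz2 : 2 / c1 < ‖z‖ ^ d := by
    have := Real.rpow_lt_rpow (by positivity) ((le_max_right _ _).trans_lt hzR) hd
    rwa [← Real.rpow_mul (by positivity), one_div_mul_cancel hd.ne', Real.rpow_one] at this
  have h3 := hkey z hz (by linarith)
  rw [div_eq_mul_one_div, Real.mul_rpow (by positivity) (by positivity)] at h3
  have h4 : c1 * ‖z‖ ^ d ≤ 1 + ‖f z‖ := by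
    rw [hc1, div_mul_eq_mul_div, div_le_iff₀ (by linarith)]
    linarith
  rw [div_lt_iff₀ hc1p] at hz2
  linarith


/-- Let `𝒜 ⊆ ℂᴺ` be an irreducible algebraic set of positive dimension
(equiv., infinite) and `f : 𝒜 → ℂᴹ` a polynomial mapping on `𝒜` such that `ℬ := f(𝒜)` is
an irreducible algebraic subset of `ℂᴹ`. Let `b ∈ ℬ`, `δ > 0`, `K := ℬ ∩ B̄(b,δ)`, and
assume `f⁻¹(K)` is compact. If `d · V_{f⁻¹(K)} ≤ V_K ∘ f` on `𝒜` for some `d > 0`, then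
`liminf_{𝒜 ∋ z → ∞} log ‖f z‖ / log ‖z‖ ≥ d`, i.e. `L∞(f|𝒜) ≥ d`. -/
theorem statement14 {N M : ℕ} (A : Set (EuclideanSpace ℂ (Fin N)))
    (f : EuclideanSpace ℂ (Fin N) → EuclideanSpace ℂ (Fin M))
    (halg : IsAlgebraicSet A) (hprime : (vanishIdeal A).IsPrime) (hinf : A.Infinite)
    (hpoly : IsPolyMapOn f A)
    (hBalg : IsAlgebraicSet (f '' A)) (hBprime : (vanishIdeal (f '' A)).IsPrime)
    (b : EuclideanSpace ℂ (Fin M)) (hb : b ∈ f '' A) (δ : ℝ) (hδ : 0 < δ)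
    (hKpre : IsCompact (A ∩ f ⁻¹' (f '' A ∩ Metric.closedBall b δ)))
    (d : ℝ) (hd : 0 < d)
    (hineq : ∀ z ∈ A,
      (d : EReal) * greenV (A ∩ f ⁻¹' (f '' A ∩ Metric.closedBall b δ)) z ≤
        greenV (f '' A ∩ Metric.closedBall b δ) (f z)) :
    (d : EReal) ≤ Filter.liminf (logRatio f) (atInftyOn A) ∧ (d : EReal) ≤ lojExp f A := by
  exact aux_main A f hBalg hBprime b hb δ hδ hKpre d hd hineq
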